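/- arXiv:2308.00432 — 2 statements merged into one kernel-verified Lean document; each statement's English description precedes it below -/
import Mathlib

section
/- Let G and H be finite metacyclic groups. If ℚG and ℚH are isomorphic as ℚ-algebras, then π_G = π_H, π'_G = π'_H, (m^G)_{π'_G} = (m^H)_{π'_H} and (n^G)_{π'_G} = (n^H)_{π'_H}. -/
open scoped Classical

noncomputable section

namespace ArXiv230800432

/-- The `σ`-part of a natural number: product of `p ^ vₚ(n)` over primes `p ∈ σ` dividing `n`. -/
def natPart (n : ℕ) (σ : Set ℕ) : ℕ :=
  ∏ p ∈ n.primeFactors, if p ∈ σ then p ^ (n.factorization p) else 1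

/-- A metacyclic factorization `G = A·B` with `A` cyclic normal and `B` cyclic. -/
structure MetacyclicFact (G : Type*) [Group G] where
  A : Subgroup G
  B : Subgroup G
  normalA : A.Normal
  cyclicA : IsCyclic A
  cyclicB : IsCyclic B
  mul_cover : ∀ g : G, ∃ x ∈ A, ∃ y ∈ B, g = x * y

/-- A group is metacyclic if it admits a metacyclic factorization. -/
def IsMetacyclic (G : Type*) [Group G] : Prop :=
  Nonempty (MetacyclicFact G)

variable {G : Type*} [Group G]

/-- `π_G`: primes `p` dividing `|G|` such that `G` has a normal Hall `p'`-subgroup. -/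
def piSet (G : Type*) [Group G] : Set ℕ :=
  {p | p.Prime ∧ p ∣ Nat.card G ∧
    ∃ N : Subgroup G, N.Normal ∧ Nat.card N = ordCompl[p] (Nat.card G)}

/-- `π'_G = π(G) \ π_G`. -/
def piSet' (G : Type*) [Group G] : Set ℕ :=
  {p | p.Prime ∧ p ∣ Nat.card G} \ piSet G

/-- The image mod `d` of `T_G(A)`: classes `[t]_d` such that some `g ∈ G` acts on `A` by
conjugation as `x ↦ x ^ t`.  For `d = |A|` this is exactly `T_G(A)`. -/
def TGmod (A : Subgroup G) (d : ℕ) : Subgroup (ZMod d)ˣ :=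
  Subgroup.closure
    {u : (ZMod d)ˣ | ∃ g : G, ∃ t : ℕ, ((t : ZMod d) = (u : ZMod d)) ∧
      ∀ x ∈ A, g⁻¹ * x * g = x ^ t}

/-- `T_G(A)` as subgroup of `(ℤ/|A|ℤ)ˣ`. -/
def TG (A : Subgroup G) : Subgroup (ZMod (Nat.card A))ˣ :=
  TGmod A (Nat.card A)

/-- The image of `T` under `Res_q : (ℤ/dℤ)ˣ → (ℤ/qℤ)ˣ` is trivial. -/
def resTriv (d q : ℕ) (T : Subgroup (ZMod d)ˣ) : Prop :=
  ∀ u ∈ T, ∀ t : ℕ, ((t : ZMod d) = (u : ZMod d)) → (t : ZMod q) = 1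

/-- The image of `T` under `Res_q` is contained in `⟨-1⟩`. -/
def resInPMOne (d q : ℕ) (T : Subgroup (ZMod d)ˣ) : Prop :=
  ∀ u ∈ T, ∀ t : ℕ, ((t : ZMod d) = (u : ZMod d)) →
    ((t : ZMod q) = 1 ∨ (t : ZMod q) = -1)

/-- The image of `T` under `Res_q` as a set of units mod `q`. -/
def resSet (d q : ℕ) (T : Subgroup (ZMod d)ˣ) : Set (ZMod q)ˣ :=
  {v | ∃ u ∈ T, ∃ t : ℕ, ((t : ZMod d) = (u : ZMod d)) ∧ ((t : ZMod q) = (v : ZMod q))}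

/-- The set of natural numbers representing elements of `T ≤ (ℤ/dℤ)ˣ`. -/
def liftSet {d : ℕ} (T : Subgroup (ZMod d)ˣ) : Set ℕ :=
  {t | ∃ u ∈ T, (t : ZMod d) = (u : ZMod d)}

/-- `r^G(A)`: the greatest divisor `r` of `|A|` such that `Res_{r_{2'}}(T_G(A)) = 1` and
`Res_{r_2}(T_G(A)) ⊆ ⟨-1⟩`. -/
def rOfA (A : Subgroup G) : ℕ :=
  sSup {r : ℕ | r ∣ Nat.card A ∧ resTriv (Nat.card A) (ordCompl[2] r) (TG A) ∧
    resInPMOne (Nat.card A) (ordProj[2] r) (TG A)}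

/-- `ε^G(A)`: `-1` if `Res_{r_2}(T_G(A)) ≠ 1`, and `1` otherwise. -/
def epsOfA (A : Subgroup G) : ℤ :=
  if resTriv (Nat.card A) (ordProj[2] (rOfA A)) (TG A) then 1 else -1

/-- `k^G(A)`: order of the image of `T_G(A)` in `(ℤ/m_ν ℤ)ˣ`, `ν` the primes dividing `|A|`
but not `r^G(A)`. -/
def kOfA (A : Subgroup G) : ℕ :=
  (resSet (Nat.card A) (natPart (Nat.card A) {p | ¬ p ∣ rOfA A}) (TG A)).ncard

/-- The triple `(|A|, r^G(A), [G:B])` attached to a metacyclic factorization. -/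
def factTriple (f : MetacyclicFact G) : ℕ × ℕ × ℕ :=
  (Nat.card f.A, rOfA f.A, f.B.index)

/-- Lexicographic order on triples. -/
def lex3 (x y : ℕ × ℕ × ℕ) : Prop :=
  x.1 < y.1 ∨ (x.1 = y.1 ∧ (x.2.1 < y.2.1 ∨ (x.2.1 = y.2.1 ∧ x.2.2 ≤ y.2.2)))

/-- A metacyclic factorization is minimal when its triple is lexicographically minimal. -/
def IsMinimalFact (f : MetacyclicFact G) : Prop :=
  ∀ f' : MetacyclicFact G, lex3 (factTriple f) (factTriple f')

def mOf (f : MetacyclicFact G) : ℕ := Nat.card f.A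
def nOf (f : MetacyclicFact G) : ℕ := f.A.index
def sOf (f : MetacyclicFact G) : ℕ := f.B.index
def rOf (f : MetacyclicFact G) : ℕ := rOfA f.A
def epsOf (f : MetacyclicFact G) : ℤ := epsOfA f.A
def kOf (f : MetacyclicFact G) : ℕ := kOfA f.A

/-- The `σ`-part of an element of a finite group. -/
def elemPart (σ : Set ℕ) (g : G) : G :=
  g ^ ((orderOf g / natPart (orderOf g) σ) *
    (((orderOf g / natPart (orderOf g) σ : ℕ) : ZMod (natPart (orderOf g) σ))⁻¹.val))

/-- The (unique, for `N` cyclic) Hall `σ`-subgroup of a subgroup `N`. -/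
def hallOf (N : Subgroup G) (σ : Set ℕ) : Subgroup G :=
  Subgroup.closure {x : G | x ∈ N ∧ orderOf x ∣ natPart (Nat.card N) σ}

/-- `R^G = T_G(G'_{π'})`, realized as a subgroup of `(ℤ/dℤ)ˣ`. -/
def ROf (G : Type*) [Group G] (d : ℕ) : Subgroup (ZMod d)ˣ :=
  TGmod (hallOf (commutator G) (piSet' G)) d

theorem prime_dvd_sum_of_iterate_eq_id {X : Type*} [Fintype X] {p n : ℕ} (hp : p.Prime)
    (σ : X → X) (hσ : σ^[p ^ n] = id) (hfix : ∀ x, σ x ≠ x) (w : X → ℕ)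
    (hw : ∀ x, w (σ x) = w x) : p ∣ ∑ x, w x := by
  have := Fact.mk hp
  have hpos := Nat.one_le_pow n p hp.pos
  let e : Equiv.Perm X := ⟨σ, σ^[p ^ n - 1],
    fun x => by rw [← Function.iterate_succ_apply, Nat.succ_eq_add_one, Nat.sub_add_cancel hpos, hσ, id],
    fun x => by rw [← Function.iterate_succ_apply' σ, Nat.succ_eq_add_one, Nat.sub_add_cancel hpos, hσ, id]⟩
  have he : e ^ p ^ n = 1 := by
    ext x
    rw [Equiv.Perm.coe_pow]
    exact congrFun hσ x
  rw [Finset.sum_comp (fun d => d) w]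
  refine Finset.dvd_sum fun d _ => Dvd.dvd.mul_right ?_ _
  by_contra hd
  let τ : Equiv.Perm {x // w x = d} := e.subtypePerm fun x => by
    rw [show w (e x) = w x from hw x]
  have hτ : τ ^ p ^ n = 1 := by
    rw [Equiv.Perm.subtypePerm_pow]
    simp only [he]
    rfl
  obtain ⟨x, hx⟩ := Equiv.Perm.exists_fixed_point_of_prime (σ := τ) (p := p) (n := n)
    (by rwa [Fintype.card_subtype]) hτ
  exact hfix x (congrArg Subtype.val hx)

instance fintypeHasEigenvalue {V : Type*} [AddCommGroup V] [Module ℂ V] [FiniteDimensional ℂ V]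
    (α : Module.End ℂ V) : Fintype {ζ : ℂ // α.HasEigenvalue ζ} :=
  inferInstanceAs (Fintype α.Eigenvalues)

theorem finrank_eq_sum_eigenspaces {V : Type*} [AddCommGroup V] [Module ℂ V]
    [FiniteDimensional ℂ V] (α : Module.End ℂ V) (hα : α.IsSemisimple) :
    Module.finrank ℂ V = ∑ ζ : {ζ : ℂ // α.HasEigenvalue ζ}, Module.finrank ℂ (α.eigenspace (ζ : ℂ)) := by
  have hind : iSupIndep fun ζ : {ζ : ℂ // α.HasEigenvalue ζ} => α.eigenspace (ζ : ℂ) :=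
    α.eigenspaces_iSupIndep.comp Subtype.val_injective
  have htop : ⨆ ζ : {ζ : ℂ // α.HasEigenvalue ζ}, α.eigenspace (ζ : ℂ) = ⊤ := by
    rw [eq_top_iff, ← hα.iSup_eigenspace_eq_top]
    refine iSup_le fun μ => ?_
    by_cases h : α.HasEigenvalue μ
    · exact le_iSup (fun ζ : {ζ : ℂ // α.HasEigenvalue ζ} => α.eigenspace (ζ : ℂ)) ⟨μ, h⟩
    · rw [Module.End.hasEigenvalue_iff, not_not] at h
      simp [h]
  have hint := DirectSum.isInternal_submodule_of_iSupIndep_of_iSup_eq_top hind htop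
  rw [← (LinearEquiv.ofBijective (DirectSum.coeLinearMap _) hint).finrank_eq, Module.finrank_directSum]

theorem isSemisimple_of_pow_eq_one {V : Type*} [AddCommGroup V] [Module ℂ V] {N : ℕ}
    (hN : N ≠ 0) (α : Module.End ℂ V) (h : α ^ N = 1) : α.IsSemisimple := by
  refine Module.End.isSemisimple_of_squarefree_aeval_eq_zero
    (p := Polynomial.X ^ N - 1) ?_ (by simp [h])
  exact ((Polynomial.X_pow_sub_one_separable_iff (F := ℂ)).2 (by exact_mod_cast hN)).squarefree

section
variable {V : Type*} [AddCommGroup V] [Module ℂ V] {α β : Module.End ℂ V} {r : ℕ}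

theorem pow_apply_mem_eigenspace (h : α * β = β * α ^ r) (i : ℕ) {ζ : ℂ} {v : V}
    (hv : v ∈ α.eigenspace ζ) :
    (β ^ i) v ∈ α.eigenspace ((fun x => x ^ r)^[i] ζ) := by
  induction i with
  | zero => simpa using hv
  | succ i ih =>
    rw [Function.iterate_succ_apply', pow_succ', Module.End.mul_apply]
    generalize (β ^ i) v = w at ih ⊢
    generalize (fun x : ℂ => x ^ r)^[i] ζ = μ at ih ⊢
    have hpow : ∀ m : ℕ, (α ^ m) w = μ ^ m • w := by
      intro m
      induction m with
      | zero => simp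
      | succ m im =>
        rw [pow_succ, Module.End.mul_apply, Module.End.mem_eigenspace_iff.1 ih, map_smul, im,
          smul_smul, pow_succ']
    rw [Module.End.mem_eigenspace_iff, ← Module.End.mul_apply, h, Module.End.mul_apply, hpow,
      map_smul]

theorem exists_pow_eq_of_not_dvd_finrank [FiniteDimensional ℂ V] {p n N : ℕ} (hp : p.Prime)
    (hN : N ≠ 0) (hα : α ^ N = 1) (hβ : β ^ p ^ n = 1) (h : α * β = β * α ^ r)
    (hdim : ¬ p ∣ Module.finrank ℂ V) : ∃ ζ : ℂ, α.HasEigenvalue ζ ∧ ζ ^ r = ζ := by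
  by_contra! hcon
  have hinj : Function.Injective β := by
    refine Function.LeftInverse.injective (g := (β ^ (p ^ n - 1) : Module.End ℂ V)) fun v => ?_
    rw [← Module.End.mul_apply, ← pow_succ, Nat.sub_add_cancel (Nat.one_le_pow _ _ hp.pos), hβ,
      Module.End.one_apply]
  have hmap : ∀ ζ : ℂ, ∀ v ∈ α.eigenspace ζ, β v ∈ α.eigenspace (ζ ^ r) := fun ζ v hv => by
    simpa using pow_apply_mem_eigenspace h 1 hv
  have hev : ∀ ζ : ℂ, α.HasEigenvalue ζ → α.HasEigenvalue (ζ ^ r) := by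
    intro ζ hζ
    obtain ⟨v, hv, hv0⟩ := hζ.exists_hasEigenvector
    exact Module.End.hasEigenvalue_of_hasEigenvector
      ⟨hmap ζ v hv, fun h0 => hv0 (hinj (h0.trans (map_zero β).symm))⟩
  let σ : {ζ : ℂ // α.HasEigenvalue ζ} → {ζ : ℂ // α.HasEigenvalue ζ} :=
    fun ζ => ⟨(ζ : ℂ) ^ r, hev _ ζ.2⟩
  have hσ : ∀ m, ∀ ζ : {ζ : ℂ // α.HasEigenvalue ζ},
      ((σ^[m] ζ : {ζ : ℂ // α.HasEigenvalue ζ}) : ℂ) = (fun x => x ^ r)^[m] (ζ : ℂ) := by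
    intro m
    induction m with
    | zero => intro ζ; rfl
    | succ m ih => intro ζ; rw [Function.iterate_succ_apply, Function.iterate_succ_apply, ih]
  have hσid : σ^[p ^ n] = id := by
    funext ζ
    apply Subtype.ext
    rw [hσ]
    obtain ⟨v, hv, hv0⟩ := Module.End.HasEigenvalue.exists_hasEigenvector ζ.2
    have h1 := pow_apply_mem_eigenspace h (p ^ n) hv
    rw [hβ, Module.End.one_apply, Module.End.mem_eigenspace_iff] at h1
    rw [Module.End.mem_eigenspace_iff] at hv
    exact (smul_left_injective ℂ hv0 (h1.symm.trans hv))
  have hle : ∀ ζ : {ζ : ℂ // α.HasEigenvalue ζ}, Module.finrank ℂ (α.eigenspace ζ.1) ≤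
      Module.finrank ℂ (α.eigenspace (σ ζ).1) := fun ζ =>
    LinearMap.finrank_le_finrank_of_injective (f := β.restrict (hmap ζ))
      (fun x y hxy => Subtype.ext (hinj (congrArg Subtype.val hxy)))
  have hle' : ∀ m, ∀ ζ : {ζ : ℂ // α.HasEigenvalue ζ}, Module.finrank ℂ (α.eigenspace ζ.1) ≤
      Module.finrank ℂ (α.eigenspace (σ^[m] ζ).1) := by
    intro m
    induction m with
    | zero => intro ζ; rfl
    | succ m ih => intro ζ; rw [Function.iterate_succ_apply]; exact (hle ζ).trans (ih _)
  refine hdim ?_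
  rw [finrank_eq_sum_eigenspaces α (isSemisimple_of_pow_eq_one hN α hα)]
  refine prime_dvd_sum_of_iterate_eq_id hp σ hσid (fun ζ hζ => hcon ζ ζ.2 (congrArg Subtype.val hζ))
    (fun ζ => Module.finrank ℂ (α.eigenspace (ζ : ℂ))) fun ζ => le_antisymm ?_ (hle ζ)
  have := hle' (p ^ n - 1) (σ ζ)
  rwa [← Function.iterate_succ_apply, Nat.succ_eq_add_one,
    Nat.sub_add_cancel (Nat.one_le_pow _ _ hp.pos), hσid] at this

theorem finrank_dvd_of_irreducible [FiniteDimensional ℂ V] [Nontrivial V] {k : ℕ} (hk : k ≠ 0)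
    (hβ : Function.Injective β) (h : α * β = β * α ^ r) (hcomm : Commute (β ^ k) α)
    (hirr : ∀ W : Submodule ℂ V, (∀ v ∈ W, α v ∈ W) → (∀ v ∈ W, β v ∈ W) → W = ⊥ ∨ W = ⊤) :
    Module.finrank ℂ V ∣ k := by
  obtain ⟨ζ, hζ⟩ := Module.End.exists_eigenvalue α
  have hinj : ∀ i : ℕ, Function.Injective (β ^ i) := fun i => by
    rw [Module.End.coe_pow]; exact hβ.iterate i
  set f : ℂ → ℂ := fun x => x ^ r
  have hper : Function.IsPeriodicPt f k ζ := by
    obtain ⟨v, hv, hv0⟩ := hζ.exists_hasEigenvector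
    have h1 := pow_apply_mem_eigenspace h k hv
    rw [Module.End.mem_eigenspace_iff] at h1 hv
    rw [← Module.End.mul_apply, ← hcomm.eq, Module.End.mul_apply, hv, map_smul] at h1
    have h2 : (β ^ k) v ≠ 0 := fun h0 => hv0 (hinj k (h0.trans (map_zero _).symm))
    exact (smul_left_injective ℂ h2 h1).symm
  set j := Function.minimalPeriod f ζ with hj
  have hjk : j ∣ k := hper.minimalPeriod_dvd
  have hj0 : 0 < j := hper.minimalPeriod_pos (Nat.pos_of_ne_zero hk)
  have hfj : f^[j] ζ = ζ := Function.isPeriodicPt_minimalPeriod f ζ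
  have hmap : ∀ v ∈ α.eigenspace ζ, (β ^ j) v ∈ α.eigenspace ζ := fun v hv => by
    have h1 := pow_apply_mem_eigenspace h j hv
    rwa [hfj] at h1
  have : Nontrivial (α.eigenspace ζ) := Submodule.nontrivial_iff_ne_bot.2 hζ
  obtain ⟨μ, hμ⟩ := Module.End.exists_eigenvalue ((β ^ j).restrict hmap)
  obtain ⟨⟨w, hw⟩, hw', hw0⟩ := hμ.exists_hasEigenvector
  have hwμ : (β ^ j) w = μ • w := congrArg Subtype.val (Module.End.mem_eigenspace_iff.1 hw')
  have hw0 : w ≠ 0 := fun h0 => hw0 (Subtype.ext h0)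
  have hmem : ∀ i : ℕ, (β ^ i) w ∈ α.eigenspace (f^[i] ζ) := fun i => pow_apply_mem_eigenspace h i hw
  have hli : LinearIndependent ℂ fun i : Fin j => (β ^ (i : ℕ)) w := by
    refine Module.End.eigenvectors_linearIndependent' α (fun i : Fin j => f^[i] ζ) ?_ _
      fun i => ⟨hmem i, fun h0 => hw0 (hinj i (h0.trans (map_zero _).symm))⟩
    intro x y hxy
    exact Fin.ext (Function.iterate_injOn_Iio_minimalPeriod x.2 y.2 hxy)
  have hspan : Submodule.span ℂ (Set.range fun i : Fin j => (β ^ (i : ℕ)) w) = ⊤ := by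
    refine (hirr _ ?_ ?_).resolve_left ?_
    · intro v hv
      induction hv using Submodule.span_induction with
      | mem x hx =>
        obtain ⟨i, rfl⟩ := hx
        rw [Module.End.mem_eigenspace_iff.1 (hmem i)]
        exact Submodule.smul_mem _ _ (Submodule.subset_span ⟨i, rfl⟩)
      | zero => simp
      | add x y _ _ hx hy => rw [map_add]; exact add_mem hx hy
      | smul c x _ hx => rw [map_smul]; exact Submodule.smul_mem _ _ hx
    · intro v hv
      induction hv using Submodule.span_induction with
      | mem x hx =>
        obtain ⟨i, rfl⟩ := hx
        simp only
        rw [← Module.End.mul_apply, ← pow_succ']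
        rcases Nat.lt_or_ge (i + 1) j with hi | hi
        · exact Submodule.subset_span ⟨⟨i + 1, hi⟩, rfl⟩
        · rw [show (i : ℕ) + 1 = j by omega, hwμ]
          exact Submodule.smul_mem _ _ (Submodule.subset_span ⟨⟨0, hj0⟩, by simp⟩)
      | zero => simp
      | add x y _ _ hx hy => rw [map_add]; exact add_mem hx hy
      | smul c x _ hx => rw [map_smul]; exact Submodule.smul_mem _ _ hx
    · intro h0
      refine hw0 ?_
      have : w ∈ Submodule.span ℂ (Set.range fun i : Fin j => (β ^ (i : ℕ)) w) :=
        Submodule.subset_span ⟨⟨0, hj0⟩, by simp⟩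
      rwa [h0, Submodule.mem_bot] at this
  have := finrank_span_eq_card hli
  rw [hspan, finrank_top, Fintype.card_fin] at this
  rwa [this]
end

/-- A complex representation of a `ℚ`-algebra without proper nonzero invariant subspaces. -/
def IsIrred {R : Type*} [Ring R] [Algebra ℚ R] {n : ℕ}
    (ρ : R →ₐ[ℚ] Module.End ℂ (Fin n → ℂ)) : Prop :=
  ∀ W : Submodule ℂ (Fin n → ℂ), (∀ x, ∀ v ∈ W, ρ x v ∈ W) → W = ⊥ ∨ W = ⊤

/-- The elements of a `ℚ`-algebra killed by all irreducible complex representations of finite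
dimension not divisible by `p`. -/
def primeToKernel (p : ℕ) (R : Type*) [Ring R] [Algebra ℚ R] : Set R :=
  {x | ∀ n : ℕ, ¬ p ∣ n → ∀ ρ : R →ₐ[ℚ] Module.End ℂ (Fin n → ℂ), IsIrred ρ → ρ x = 0}

theorem mem_primeToKernel_of_algEquiv {p : ℕ} {R S : Type*} [Ring R] [Algebra ℚ R] [Ring S]
    [Algebra ℚ S] (e : R ≃ₐ[ℚ] S) {x : R} (hx : x ∈ primeToKernel p R) :
    e x ∈ primeToKernel p S := by
  intro n hn ρ hρ
  refine hx n hn (ρ.comp (e : R →ₐ[ℚ] S)) fun W hW => hρ W fun y v hv => ?_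
  have := hW (e.symm y) v hv
  simpa using this

theorem forall_mem_of_forall_of_mem {G : Type*} [Group G] {n : ℕ}
    (ρ : MonoidAlgebra ℚ G →ₐ[ℚ] Module.End ℂ (Fin n → ℂ)) (W : Submodule ℂ (Fin n → ℂ))
    (hW : ∀ g : G, ∀ v ∈ W, ρ (MonoidAlgebra.of ℚ G g) v ∈ W) (x : MonoidAlgebra ℚ G) :
    ∀ v ∈ W, ρ x v ∈ W := by
  intro v hv
  induction x using MonoidAlgebra.induction_on with
  | of g => exact hW g v hv
  | add x y hx hy => rw [map_add]; exact add_mem hx hy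
  | smul q x hx =>
    rw [map_smul, LinearMap.smul_apply, ← algebraMap_smul ℂ q]
    exact W.smul_mem _ hx

section
variable {G V : Type*} [Group G] [Finite G] [AddCommGroup V] [Module ℂ V] [FiniteDimensional ℂ V]
  {a b : G} {p k n r s : ℕ}

theorem map_eq_one_of_not_dvd_finrank (φ : G →* Module.End ℂ V)
    (hirr : ∀ W : Submodule ℂ V, (∀ g, ∀ v ∈ W, φ g v ∈ W) → W = ⊥ ∨ W = ⊤)
    (hp : p.Prime) (hc : (b ^ k) ^ p ^ n = 1) (hs : a * b ^ k = b ^ k * a ^ s)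
    (hK : (Subgroup.zpowers (a ^ s * a⁻¹)).Normal) (hdim : ¬ p ∣ Module.finrank ℂ V) :
    φ (a ^ s * a⁻¹) = 1 := by
  set z := a ^ s * a⁻¹ with hz
  obtain ⟨ζ, hζ, hζs⟩ := exists_pow_eq_of_not_dvd_finrank (α := φ a) (β := φ (b ^ k)) (r := s)
    hp (orderOf_pos a).ne' (by rw [← map_pow, pow_orderOf_eq_one, map_one])
    (by rw [← map_pow, hc, map_one]) (by rw [← map_pow, ← map_mul, ← map_mul, hs]) hdim
  obtain ⟨v, hv, hv0⟩ := hζ.exists_hasEigenvector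
  rw [Module.End.mem_eigenspace_iff] at hv
  have hpow : ∀ m : ℕ, φ (a ^ m) v = ζ ^ m • v := by
    intro m
    induction m with
    | zero => simp
    | succ m im =>
      rw [pow_succ, map_mul, Module.End.mul_apply, hv, map_smul, im, smul_smul, pow_succ']
  have hzv : φ z v = v := by
    have h1 : φ z (φ a v) = φ a v := by
      rw [← Module.End.mul_apply, ← map_mul, hz, inv_mul_cancel_right, hpow, hζs, hv]
    have hζ0 : ζ ≠ 0 := by
      rintro rfl
      have : φ (a⁻¹) (φ a v) = v := by
        rw [← Module.End.mul_apply, ← map_mul, inv_mul_cancel, map_one, Module.End.one_apply]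
      rw [hv, zero_smul, map_zero] at this
      exact hv0 this.symm
    rw [hv, map_smul] at h1
    exact smul_right_injective V hζ0 h1
  let W : Submodule ℂ V := (φ z).eigenspace 1
  have hW : ∀ w, w ∈ W ↔ φ z w = w := fun w => by
    rw [Module.End.mem_eigenspace_iff, one_smul]
  have hpowW : ∀ w ∈ W, ∀ m : ℕ, φ (z ^ m) w = w := by
    intro w hw m
    induction m with
    | zero => simp
    | succ m im => rw [pow_succ, map_mul, Module.End.mul_apply, (hW w).1 hw, im]
  have key : W = ⊤ := by
    refine (hirr W ?_).resolve_left fun h0 => hv0 ?_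
    · intro g w hw
      rw [hW, ← Module.End.mul_apply, ← map_mul]
      have hmem : g⁻¹ * z * g ∈ Subgroup.zpowers z := by
        simpa using hK.conj_mem z (Subgroup.mem_zpowers z) g⁻¹
      obtain ⟨m, hm⟩ := mem_zpowers_iff_mem_range_orderOf.1 hmem |> Finset.mem_image.1
      have : z * g = g * z ^ m := by rw [hm.2]; group
      rw [this, map_mul, Module.End.mul_apply, hpowW w hw]
    · have : v ∈ W := (hW v).2 hzv
      rwa [h0, Submodule.mem_bot] at this
  ext w
  exact (hW w).1 (key ▸ Submodule.mem_top)

theorem finrank_dvd_of_map_eq_one [Nontrivial V] (φ : G →* Module.End ℂ V)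
    (hirr : ∀ W : Submodule ℂ V, (∀ g, ∀ v ∈ W, φ g v ∈ W) → W = ⊥ ∨ W = ⊤)
    (hgen : Subgroup.closure {a, b} = ⊤) (hr : a * b = b * a ^ r)
    (hk : k ≠ 0) (hs : a * b ^ k = b ^ k * a ^ s) (h1 : φ (a ^ s * a⁻¹) = 1) :
    Module.finrank ℂ V ∣ k := by
  refine finrank_dvd_of_irreducible (α := φ a) (β := φ b) (r := r) hk ?_
    (by rw [← map_pow, ← map_mul, ← map_mul, hr]) ?_ ?_
  · refine Function.LeftInverse.injective (g := φ b⁻¹) fun v => ?_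
    rw [← Module.End.mul_apply, ← map_mul, inv_mul_cancel, map_one, Module.End.one_apply]
  · have : φ (a ^ s) = φ a := by
      rw [show a ^ s = (a ^ s * a⁻¹) * a by group, map_mul, h1, one_mul]
    rw [← map_pow, commute_iff_eq, ← map_mul, ← map_mul, hs, map_mul, map_mul, this]
  · intro W ha hb
    refine hirr W fun g => ?_
    have hg : g ∈ Submonoid.closure ({a, b} : Set G) := by
      rw [← Subgroup.closure_toSubmonoid_of_finite, hgen]; exact Submonoid.mem_top g
    induction hg using Submonoid.closure_induction with
    | mem x hx =>
      rcases hx with rfl | rfl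
      · exact ha
      · exact hb
    | one => intro v hv; simpa using hv
    | mul x y _ _ hx hy => intro v hv; rw [map_mul]; exact hx _ (hy _ hv)
end

theorem exists_isIrred_apply_ne_zero {Q : Type*} [Group Q] [Finite Q] {y : MonoidAlgebra ℚ Q}
    (hy : y ≠ 0) : ∃ n : ℕ, n ≠ 0 ∧ ∃ ρ : MonoidAlgebra ℚ Q →ₐ[ℚ] Module.End ℂ (Fin n → ℂ),
      IsIrred ρ ∧ ρ y ≠ 0 := by
  let ψ : MonoidAlgebra ℚ Q →ₐ[ℚ] MonoidAlgebra ℂ Q :=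
    MonoidAlgebra.mapAlgHom Q (Algebra.ofId ℚ ℂ)
  have hψof : ∀ q, ψ (MonoidAlgebra.of ℚ Q q) = MonoidAlgebra.of ℂ Q q := fun q => by simp [ψ]
  have hψ : ψ y ≠ 0 := by
    intro h0
    refine hy (MonoidAlgebra.ext (Finsupp.ext fun q => ?_))
    have := congrArg (fun f => MonoidAlgebra.coeff f q) h0
    simpa [ψ] using this
  obtain ⟨S, hS, m, hm⟩ : ∃ S : Submodule (MonoidAlgebra ℂ Q) (MonoidAlgebra ℂ Q),
      IsSimpleModule (MonoidAlgebra ℂ Q) S ∧ ∃ m : S, ψ y • m ≠ 0 := by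
    by_contra! hcon
    have h1 : ψ y ∈ (⊤ : Submodule (MonoidAlgebra ℂ Q) (MonoidAlgebra ℂ Q)).annihilator := by
      rw [← IsSemisimpleModule.sSup_simples_eq_top, sSup_eq_iSup', Submodule.annihilator_iSup,
        Submodule.mem_iInf]
      rintro ⟨S, hS⟩
      rw [Submodule.mem_annihilator]
      intro m hm
      exact congrArg Subtype.val (hcon S hS ⟨m, hm⟩)
    rw [Submodule.mem_annihilator] at h1
    exact hψ (by simpa using h1 1 trivial)
  have : Module.Finite ℂ S := by
    have : Module.Finite ℂ (MonoidAlgebra ℂ Q) := inferInstance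
    exact Module.Finite.of_injective (S.subtype.restrictScalars ℂ) S.injective_subtype
  let e : S ≃ₗ[ℂ] (Fin (Module.finrank ℂ S) → ℂ) := (Module.finBasis ℂ S).equivFun
  let ρ : MonoidAlgebra ℚ Q →ₐ[ℚ] Module.End ℂ (Fin (Module.finrank ℂ S) → ℂ) :=
    (((e.conjAlgEquiv ℂ : _ →ₐ[ℂ] _).comp (Algebra.lsmul ℂ ℂ S)).restrictScalars ℚ).comp ψ
  have hρ : ∀ x v, ρ x v = e (ψ x • e.symm v) := fun x v => rfl
  have hnt : Nontrivial S := IsSimpleModule.nontrivial (MonoidAlgebra ℂ Q) S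
  refine ⟨Module.finrank ℂ S, Module.finrank_pos.ne', ρ, ?_, fun h0 => hm ?_⟩
  · intro W hW
    let W' : Submodule (MonoidAlgebra ℂ Q) S :=
      MonoidAlgebra.submoduleOfSMulMem (W.comap e.toLinearMap) fun q v hv => by
        have := hW (MonoidAlgebra.of ℚ Q q) (e v) hv
        rw [hρ, hψof, LinearEquiv.symm_apply_apply] at this
        exact this
    have hW' : ∀ v, v ∈ W' ↔ e v ∈ W := fun v => Iff.rfl
    rcases eq_bot_or_eq_top W' with h | h
    · left
      rw [eq_bot_iff]
      intro v hv
      have h2 : e.symm v ∈ W' := (hW' _).2 (by rwa [LinearEquiv.apply_symm_apply])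
      rw [h, Submodule.mem_bot] at h2
      rw [Submodule.mem_bot, ← e.apply_symm_apply v, h2, map_zero]
    · right
      rw [eq_top_iff]
      intro v _
      have h2 : e.symm v ∈ W' := h ▸ Submodule.mem_top
      rwa [hW', LinearEquiv.apply_symm_apply] at h2
  · have := LinearMap.congr_fun h0 (e m)
    rw [hρ, LinearEquiv.symm_apply_apply, LinearMap.zero_apply] at this
    exact (map_eq_zero_iff e e.injective).1 this

theorem mem_primeToKernel_iff {G : Type*} [Group G] [Finite G] {a b : G} {p k n r s : ℕ}
    (hp : p.Prime) (hgen : Subgroup.closure {a, b} = ⊤) (hr : a * b = b * a ^ r)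
    (hc : (b ^ k) ^ p ^ n = 1) (hk : ¬ p ∣ k) (hs : a * b ^ k = b ^ k * a ^ s)
    (K : Subgroup G) [K.Normal] (hK : K = Subgroup.zpowers (a ^ s * a⁻¹))
    (x : MonoidAlgebra ℚ G) :
    x ∈ primeToKernel p (MonoidAlgebra ℚ G) ↔
      MonoidAlgebra.mapDomainAlgHom ℚ ℚ (QuotientGroup.mk' K) x = 0 := by
  constructor
  · intro hx
    by_contra h0
    obtain ⟨d, hd, ρ, hρ, hne⟩ := exists_isIrred_apply_ne_zero h0
    have : NeZero d := ⟨hd⟩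
    let ρ' := ρ.comp (MonoidAlgebra.mapDomainAlgHom ℚ ℚ (QuotientGroup.mk' K))
    have hρ' : IsIrred ρ' := by
      intro W hW
      refine hρ W (forall_mem_of_forall_of_mem ρ W fun q v hv => ?_)
      obtain ⟨g, rfl⟩ := QuotientGroup.mk'_surjective K q
      simpa [ρ'] using hW (MonoidAlgebra.of ℚ G g) v hv
    refine hne (hx d (fun hpd => hk (hpd.trans ?_)) ρ' hρ')
    have := finrank_dvd_of_map_eq_one (V := Fin d → ℂ) (k := k) (r := r) (s := s) (a := a) (b := b)
      ((ρ' : MonoidAlgebra ℚ G →* _).comp (MonoidAlgebra.of ℚ G))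
      (fun W hW => hρ' W (forall_mem_of_forall_of_mem ρ' W hW)) hgen hr
      (fun h => hk (h ▸ dvd_zero p)) hs ?_
    · simpa using this
    · have : QuotientGroup.mk' K (a ^ s * a⁻¹) = 1 := by
        rw [QuotientGroup.mk'_apply, QuotientGroup.eq_one_iff, hK]
        exact Subgroup.mem_zpowers _
      change ρ (MonoidAlgebra.mapDomainAlgHom ℚ ℚ (QuotientGroup.mk' K)
        (MonoidAlgebra.of ℚ G (a ^ s * a⁻¹))) = 1
      rw [MonoidAlgebra.of_apply, MonoidAlgebra.mapDomainAlgHom_apply,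
        MonoidAlgebra.mapDomain_single, this, ← MonoidAlgebra.one_def, map_one]
  · intro hx d hd ρ hρ
    let φ : G →* Module.End ℂ (Fin d → ℂ) :=
      (ρ : MonoidAlgebra ℚ G →* _).comp (MonoidAlgebra.of ℚ G)
    have h1 : φ (a ^ s * a⁻¹) = 1 :=
      map_eq_one_of_not_dvd_finrank φ (fun W hW => hρ W (forall_mem_of_forall_of_mem ρ W hW))
        hp hc hs (hK ▸ inferInstance) (by simpa using hd)
    have hker : K ≤ φ.ker := by
      rw [hK, Subgroup.zpowers_le]
      exact h1
    have hfac : ρ = (MonoidAlgebra.lift ℚ (Module.End ℂ (Fin d → ℂ)) (G ⧸ K)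
        (QuotientGroup.lift K φ hker)).comp
        (MonoidAlgebra.mapDomainAlgHom ℚ ℚ (QuotientGroup.mk' K)) := by
      refine MonoidAlgebra.algHom_ext (fun g => ?_) (Subsingleton.elim _ _)
      simp [φ]
    rw [hfac, AlgHom.comp_apply, hx, map_zero]

theorem mapDomainAlgHom_mk'_surjective {G : Type*} [Group G] (K : Subgroup G) [K.Normal] :
    Function.Surjective (MonoidAlgebra.mapDomainAlgHom ℚ ℚ (QuotientGroup.mk' K)) := by
  intro x
  induction x using MonoidAlgebra.induction_on with
  | of q =>
    obtain ⟨g, rfl⟩ := QuotientGroup.mk'_surjective K q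
    exact ⟨MonoidAlgebra.of ℚ G g, by simp⟩
  | add x y hx hy =>
    obtain ⟨x, rfl⟩ := hx
    obtain ⟨y, rfl⟩ := hy
    exact ⟨x + y, map_add _ _ _⟩
  | smul c x hx =>
    obtain ⟨x, rfl⟩ := hx
    exact ⟨c • x, map_smul _ _ _⟩

theorem finrank_monoidAlgebra (Q : Type*) [Group Q] [Finite Q] :
    Module.finrank ℚ (MonoidAlgebra ℚ Q) = Nat.card Q :=
  Module.finrank_eq_nat_card_basis (MonoidAlgebra.basis Q ℚ)

theorem card_quotient_eq_of_ker_iff {G H : Type*} [Group G] [Group H] [Finite G] [Finite H]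
    (e : MonoidAlgebra ℚ G ≃ₐ[ℚ] MonoidAlgebra ℚ H) (K : Subgroup G) [K.Normal] (L : Subgroup H)
    [L.Normal] (h : ∀ x, MonoidAlgebra.mapDomainAlgHom ℚ ℚ (QuotientGroup.mk' K) x = 0 ↔
      MonoidAlgebra.mapDomainAlgHom ℚ ℚ (QuotientGroup.mk' L) (e x) = 0) :
    Nat.card (G ⧸ K) = Nat.card (H ⧸ L) := by
  let f := (MonoidAlgebra.mapDomainAlgHom ℚ ℚ (QuotientGroup.mk' K)).toLinearMap
  let g := (MonoidAlgebra.mapDomainAlgHom ℚ ℚ (QuotientGroup.mk' L)).toLinearMap ∘ₗ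
    e.toLinearEquiv.toLinearMap
  have hf : Function.Surjective f := mapDomainAlgHom_mk'_surjective K
  have hg : Function.Surjective g := (mapDomainAlgHom_mk'_surjective L).comp e.surjective
  have hker : LinearMap.ker f = LinearMap.ker g := by
    ext x
    exact h x
  have := ((f.quotKerEquivOfSurjective hf).symm.trans
    ((Submodule.quotEquivOfEq _ _ hker).trans (g.quotKerEquivOfSurjective hg))).finrank_eq
  rwa [finrank_monoidAlgebra, finrank_monoidAlgebra] at this

theorem card_eq_of_algEquiv {G H : Type*} [Group G] [Group H] [Finite G] [Finite H]
    (e : MonoidAlgebra ℚ G ≃ₐ[ℚ] MonoidAlgebra ℚ H) : Nat.card G = Nat.card H := by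
  have := e.toLinearEquiv.finrank_eq
  rwa [finrank_monoidAlgebra, finrank_monoidAlgebra] at this

theorem card_algHom_complex (Q : Type*) [Group Q] [Finite Q] :
    Nat.card (MonoidAlgebra ℚ Q →ₐ[ℚ] ℂ) = Nat.card (Abelianization Q) := by
  have e : (Q →* ℂ) ≃ (Q →* ℂˣ) :=
    { toFun := fun f => f.toHomUnits
      invFun := fun f => (Units.coeHom ℂ).comp f
      left_inv := fun f => by ext; rfl
      right_inv := fun f => by ext; rfl }
  have : Finite (Abelianization Q) := inferInstanceAs (Finite (Q ⧸ commutator Q))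
  have : NeZero (Monoid.exponent (Abelianization Q)) := ⟨Monoid.exponent_ne_zero_of_finite⟩
  rw [Nat.card_congr ((MonoidAlgebra.lift ℚ ℂ Q).symm.trans (e.trans Abelianization.lift)),
    CommGroup.card_monoidHom_of_hasEnoughRootsOfUnity]

theorem card_commutator_eq_of_algEquiv {G H : Type*} [Group G] [Group H] [Finite G] [Finite H]
    (e : MonoidAlgebra ℚ G ≃ₐ[ℚ] MonoidAlgebra ℚ H) :
    Nat.card (commutator G) = Nat.card (commutator H) := by
  have h1 : Nat.card (G ⧸ commutator G) = Nat.card (H ⧸ commutator H) := by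
    have := Nat.card_congr (e.arrowCongr (AlgEquiv.refl : ℂ ≃ₐ[ℚ] ℂ))
    rwa [card_algHom_complex, card_algHom_complex] at this
  have h2 := card_eq_of_algEquiv e
  rw [Subgroup.card_eq_card_quotient_mul_card_subgroup (commutator G),
    Subgroup.card_eq_card_quotient_mul_card_subgroup (commutator H), h1] at h2
  exact Nat.eq_of_mul_eq_mul_left Nat.card_pos h2

section
variable {G : Type*} [Group G] {a b : G} {p : ℕ}

theorem exists_mul_eq_mul_pow_succ [Finite G] (hA : (Subgroup.zpowers a).Normal) (g : G) :
    ∃ m : ℕ, a * g = g * a ^ (m + 1) := by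
  have hmem : g⁻¹ * a * g ∈ Subgroup.zpowers a := by
    simpa using hA.conj_mem a (Subgroup.mem_zpowers a) g⁻¹
  obtain ⟨i, hi⟩ := mem_powers_iff_mem_zpowers.2 hmem
  refine ⟨i + (orderOf a - 1), ?_⟩
  rw [add_assoc, Nat.sub_add_cancel (orderOf_pos a), pow_add, pow_orderOf_eq_one, mul_one]
  simp only at hi
  rw [hi]
  group

theorem pow_mul_eq_mul_pow {g : G} {m : ℕ} (h : a * g = g * a ^ m) (i : ℕ) :
    a ^ i * g = g * a ^ (m * i) := by
  induction i with
  | zero => simp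
  | succ i ih => rw [pow_succ', mul_assoc, ih, ← mul_assoc, h, mul_assoc, ← pow_add]; ring_nf

theorem mul_pow_eq_pow_mul {g : G} {m : ℕ} (h : a * g = g * a ^ m) (i : ℕ) :
    a * g ^ i = g ^ i * a ^ (m ^ i) := by
  induction i with
  | zero => simp
  | succ i ih => rw [pow_succ, ← mul_assoc, ih, mul_assoc, pow_mul_eq_mul_pow h, ← mul_assoc,
      ← pow_succ']

theorem normal_zpowers_pow (hA : (Subgroup.zpowers a).Normal) (i : ℕ) :
    (Subgroup.zpowers (a ^ i)).Normal := by
  refine ⟨fun x hx g => ?_⟩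
  obtain ⟨j, rfl⟩ := hx
  obtain ⟨l, hl⟩ := hA.conj_mem a (Subgroup.mem_zpowers a) g
  refine ⟨l * j, ?_⟩
  simp only at hl ⊢
  rw [← conj_zpow, ← conj_pow, ← hl, ← zpow_natCast, ← zpow_natCast, ← zpow_mul, ← zpow_mul,
    ← zpow_mul]
  ring_nf

theorem mem_center_of_commute {Q : Type*} [Group Q] (hgen : Subgroup.closure {a, b} = ⊤)
    (f : G →* Q) (hf : Function.Surjective f) {x : Q} (ha : Commute x (f a))
    (hb : Commute x (f b)) : x ∈ Subgroup.center Q := by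
  have h1 : Subgroup.closure {a, b} ≤ (Subgroup.centralizer {x}).comap f := by
    rw [Subgroup.closure_le]
    rintro y (rfl | rfl)
    · exact Subgroup.mem_centralizer_singleton_iff.2 ha.symm.eq
    · exact Subgroup.mem_centralizer_singleton_iff.2 hb.symm.eq
  rw [Subgroup.mem_center_iff]
  intro y
  obtain ⟨g, rfl⟩ := hf y
  have : g ∈ Subgroup.closure {a, b} := hgen ▸ Subgroup.mem_top g
  exact Subgroup.mem_centralizer_singleton_iff.1 (h1 this)

theorem pow_mem_commutator {g : G} {m : ℕ} (h : a * g = g * a ^ (m + 1)) :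
    a ^ m ∈ commutator G := by
  have : a ^ m = g⁻¹ * a * g⁻¹⁻¹ * a⁻¹ := by
    rw [inv_inv, mul_assoc g⁻¹, h, pow_succ]
    group
  rw [this]
  exact Subgroup.commutator_mem_commutator (Subgroup.mem_top _) (Subgroup.mem_top _)

theorem commutator_eq_zpowers (hA : (Subgroup.zpowers a).Normal)
    (hgen : Subgroup.closure {a, b} = ⊤) {r : ℕ} (hr : a * b = b * a ^ (r + 1)) :
    commutator G = Subgroup.zpowers (a ^ r) := by
  refine le_antisymm ?_ (by rw [Subgroup.zpowers_le]; exact pow_mem_commutator hr)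
  have hN := normal_zpowers_pow hA r
  set N := Subgroup.zpowers (a ^ r)
  let f := QuotientGroup.mk' N
  have hf := QuotientGroup.mk'_surjective N
  have h1 : f (a ^ r) = 1 := (QuotientGroup.eq_one_iff _).2 (Subgroup.mem_zpowers _)
  have hab : Commute (f a) (f b) := by
    rw [commute_iff_eq, ← map_mul, hr, pow_succ, map_mul, map_mul, h1, one_mul]
  have hac := mem_center_of_commute hgen f hf (Commute.refl (f a)) hab
  have hbc := mem_center_of_commute hgen f hf hab.symm (Commute.refl (f b))
  rw [← Subgroup.Normal.quotient_commutative_iff_commutator_le]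
  refine ⟨⟨fun x y => ?_⟩⟩
  have := mem_center_of_commute hgen f hf (x := x) (Subgroup.mem_center_iff.1 hac x)
    (Subgroup.mem_center_iff.1 hbc x)
  exact (Subgroup.mem_center_iff.1 this y).symm

theorem mem_zpowers_pow_of_coprime {g : G} {k q : ℕ} (h : k.Coprime q) :
    ∃ i j : ℤ, g = (g ^ k) ^ i * (g ^ q) ^ j := by
  refine ⟨k.gcdA q, k.gcdB q, ?_⟩
  have := Nat.gcd_eq_gcd_ab k q
  rw [h] at this
  rw [← zpow_natCast, ← zpow_natCast, ← zpow_mul, ← zpow_mul, ← zpow_add, ← this]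
  simp

theorem commute_of_commute_pow_of_coprime {g x : G} {k q : ℕ} (h : k.Coprime q)
    (h1 : Commute x (g ^ k)) (h2 : Commute x (g ^ q)) : Commute x g := by
  obtain ⟨i, j, hij⟩ := mem_zpowers_pow_of_coprime (g := g) h
  rw [hij]
  exact (h1.zpow_right i).mul_right (h2.zpow_right j)

theorem eq_one_of_pow_eq_one_of_coprime {G : Type*} [Group G] {x : G} {m n : ℕ} (h : m.Coprime n)
    (hm : x ^ m = 1) (hn : x ^ n = 1) : x = 1 := by
  rw [← orderOf_eq_one_iff, ← Nat.dvd_one, ← h]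
  exact Nat.dvd_gcd (orderOf_dvd_of_pow_eq_one hm) (orderOf_dvd_of_pow_eq_one hn)

/-- If `t ^ k ≡ 1` and `p ∤ k`, then `t ≡ 1 [MOD p]` lifts to `t ≡ 1 [MOD p ^ e]`. -/
theorem pow_dvd_of_pow_succ_pow_modEq_one {k e m : ℕ} (hp : p.Prime) (hk : ¬ p ∣ k) (hm : p ∣ m)
    (h : (m + 1) ^ k ≡ 1 [MOD p ^ e]) : p ^ e ∣ m := by
  have h1 : p ^ e ∣ (m + 1) ^ k - 1 := (Nat.modEq_iff_dvd' (Nat.one_le_pow _ _ (by omega))).1 h.symm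
  have h3 : (∑ i ∈ Finset.range k, (m + 1) ^ i) * m = (m + 1) ^ k - 1 := by
    have := geom_sum_mul_add m k
    omega
  rw [← h3] at h1
  refine Nat.Coprime.dvd_of_dvd_mul_left (Nat.Coprime.pow_left _ ((hp.coprime_iff_not_dvd).2 ?_)) h1
  intro h4
  refine hk ?_
  rw [← ZMod.natCast_eq_zero_iff] at h4 hm ⊢
  simpa [hm] using h4

/-- The `p'`-part of `b` centralizes the `p`-part of `⟨a⟩`. -/
def PPrimeCentral (p : ℕ) (a b : G) : Prop :=
  Commute (b ^ ordProj[p] (orderOf b)) (a ^ ordCompl[p] (orderOf a))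

theorem coprime_ordCompl_ordProj (hp : p.Prime) {n : ℕ} (hn : n ≠ 0) :
    (ordCompl[p] n).Coprime (ordProj[p] n) :=
  ((Nat.coprime_ordCompl hp hn).pow_left _).symm

theorem pPrimeCentral_of_mem_piSet [Finite G] (hA : (Subgroup.zpowers a).Normal) (h : p ∈ piSet G) :
    PPrimeCentral p a b := by
  obtain ⟨hp, -, N, hN, hcard⟩ := h
  have hG : Nat.card G ≠ 0 := Nat.card_pos.ne'
  set d := b ^ ordProj[p] (orderOf b) with hd
  have hdk : d ^ ordCompl[p] (orderOf b) = 1 := by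
    rw [hd, ← pow_mul, Nat.ordProj_mul_ordCompl_eq_self, pow_orderOf_eq_one]
  have hquot : Nat.card (G ⧸ N) = ordProj[p] (Nat.card G) := by
    have h1 := Subgroup.card_eq_card_quotient_mul_card_subgroup N
    rw [hcard] at h1
    refine Nat.eq_of_mul_eq_mul_right (Nat.ordCompl_pos p hG) (h1.symm.trans ?_)
    rw [Nat.ordProj_mul_ordCompl_eq_self]
  have hdN : d ∈ N := by
    rw [← QuotientGroup.eq_one_iff]
    refine eq_one_of_pow_eq_one_of_coprime (m := ordCompl[p] (orderOf b))
      (n := ordProj[p] (Nat.card G)) ?_ ?_ ?_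
    · exact ((Nat.coprime_ordCompl hp (orderOf_pos b).ne').pow_left _).symm
    · rw [← QuotientGroup.mk_pow, hdk, QuotientGroup.mk_one]
    · rw [← hquot]
      exact pow_card_eq_one'
  obtain ⟨m, hm⟩ := exists_mul_eq_mul_pow_succ hA d
  set u := ordCompl[p] (orderOf a) with hu
  have h1 := pow_mul_eq_mul_pow hm u
  have h2 : a ^ (m * u) = 1 := by
    have h3 : a ^ (m * u) = d⁻¹ * (a ^ u * d * (a ^ u)⁻¹) := by
      rw [h1, show (m + 1) * u = m * u + u by ring, pow_add]
      group
    have hmem : a ^ (m * u) ∈ N := by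
      rw [h3]
      exact mul_mem (inv_mem hdN) (hN.conj_mem d hdN _)
    refine eq_one_of_pow_eq_one_of_coprime (m := Nat.card N) (n := ordProj[p] (orderOf a)) ?_ ?_ ?_
    · rw [hcard]
      exact ((Nat.coprime_ordCompl hp hG).pow_left _).symm
    · have := pow_card_eq_one' (G := N) (x := ⟨_, hmem⟩)
      exact congrArg Subtype.val this
    · rw [← pow_mul, mul_assoc, mul_comm u, Nat.ordProj_mul_ordCompl_eq_self, mul_comm, pow_mul,
        pow_orderOf_eq_one, one_pow]
  rw [PPrimeCentral, commute_iff_eq, h1, show (m + 1) * u = m * u + u by ring, pow_add, h2, one_mul]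

theorem mem_piSet_of_pPrimeCentral [Finite G] (hp : p.Prime) (hpG : p ∣ Nat.card G)
    (hA : (Subgroup.zpowers a).Normal) (hgen : Subgroup.closure {a, b} = ⊤)
    (h : PPrimeCentral p a b) : p ∈ piSet G := by
  have ha0 := (orderOf_pos a).ne'
  have hb0 := (orderOf_pos b).ne'
  have hG : Nat.card G ≠ 0 := Nat.card_pos.ne'
  refine ⟨hp, hpG, ?_⟩
  rw [PPrimeCentral] at h
  set d := b ^ ordProj[p] (orderOf b) with hd
  have hdk : d ^ ordCompl[p] (orderOf b) = 1 := by
    rw [hd, ← pow_mul, Nat.ordProj_mul_ordCompl_eq_self, pow_orderOf_eq_one]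
  have hA' := normal_zpowers_pow hA (ordProj[p] (orderOf a))
  set A' := Subgroup.zpowers (a ^ ordProj[p] (orderOf a)) with hA'def
  let f := QuotientGroup.mk' A'
  have hf : Function.Surjective f := QuotientGroup.mk'_surjective A'
  have hfa : f a ^ ordProj[p] (orderOf a) = 1 := by
    rw [← map_pow]
    exact (QuotientGroup.eq_one_iff _).2 (Subgroup.mem_zpowers _)
  have hcen : f d ∈ Subgroup.center (G ⧸ A') := by
    refine mem_center_of_commute hgen f hf ?_ ?_
    · refine commute_of_commute_pow_of_coprime (coprime_ordCompl_ordProj hp ha0) ?_ ?_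
      · rw [← map_pow]
        exact h.map f
      · rw [hfa]
        exact Commute.one_right _
    · exact ((Commute.refl b).pow_left _).map f
  have hD : (Subgroup.zpowers (f d)).Normal := by
    refine ⟨fun x hx g => ?_⟩
    have : x ∈ Subgroup.center (G ⧸ A') := (Subgroup.zpowers_le.2 hcen) hx
    rw [Subgroup.mem_center_iff.1 this g, mul_inv_cancel_right]
    exact hx
  let N := (Subgroup.zpowers (f d)).comap f
  have hN : N.Normal := hD.comap f
  refine ⟨N, hN, ?_⟩
  have hAN : A' ≤ N := by
    intro x hx
    have : f x = 1 := (QuotientGroup.eq_one_iff _).2 hx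
    rw [Subgroup.mem_comap, this]
    exact one_mem _
  have hcop : ¬ p ∣ Nat.card N := by
    have h1 : Nat.card N = Nat.card A' * orderOf (f d) := by
      have h2 := Subgroup.card_mul_index N
      have h3 := Subgroup.card_mul_index (Subgroup.zpowers (f d))
      rw [← Subgroup.index_comap_of_surjective _ hf, Nat.card_zpowers] at h3
      have h4 := Subgroup.card_eq_card_quotient_mul_card_subgroup A'
      rw [← h3, ← h2] at h4
      refine Nat.eq_of_mul_eq_mul_right (Nat.pos_of_ne_zero N.index_ne_zero_of_finite) (h4.trans ?_)
      ring
    have h0 : Nat.card A' = orderOf (a ^ ordProj[p] (orderOf a)) := Nat.card_zpowers _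
    rw [h1, hp.dvd_mul, h0]
    have h5 : orderOf (a ^ ordProj[p] (orderOf a)) ∣ ordCompl[p] (orderOf a) :=
      orderOf_dvd_of_pow_eq_one (by
        rw [← pow_mul, Nat.ordProj_mul_ordCompl_eq_self, pow_orderOf_eq_one])
    have h6 : orderOf (f d) ∣ ordCompl[p] (orderOf b) :=
      orderOf_dvd_of_pow_eq_one (by rw [← map_pow, hdk, map_one])
    rintro (h7 | h7)
    · exact Nat.not_dvd_ordCompl hp ha0 (h7.trans h5)
    · exact Nat.not_dvd_ordCompl hp hb0 (h7.trans h6)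
  have hpgroup : IsPGroup p (G ⧸ N) := by
    let g := QuotientGroup.mk' N
    have hg : Function.Surjective g := QuotientGroup.mk'_surjective N
    have hga : g a ^ ordProj[p] (orderOf a) = 1 := by
      rw [← map_pow]
      exact (QuotientGroup.eq_one_iff _).2 (hAN (Subgroup.mem_zpowers _))
    have hgb : g b ^ ordProj[p] (orderOf b) = 1 := by
      rw [← map_pow]
      exact (QuotientGroup.eq_one_iff _).2 (Subgroup.mem_zpowers (f d))
    have hz : ∀ x : G ⧸ N, ∀ i, x ^ p ^ i = 1 → IsPGroup p (Subgroup.zpowers x) := by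
      rintro x i hx ⟨y, j, rfl⟩
      refine ⟨i, Subtype.ext ?_⟩
      simp only [SubmonoidClass.coe_pow, OneMemClass.coe_one]
      rw [← zpow_natCast, ← zpow_mul, mul_comm, zpow_mul, zpow_natCast, hx, one_zpow]
    have hn : (Subgroup.zpowers (g a)).Normal := by
      rw [← MonoidHom.map_zpowers]
      exact hA.map g hg
    have hsup := IsPGroup.to_sup_of_normal_left (hz _ _ hga) (hz _ _ hgb)
    have htop : Subgroup.zpowers (g a) ⊔ Subgroup.zpowers (g b) = ⊤ := by
      rw [← MonoidHom.map_zpowers, ← MonoidHom.map_zpowers, ← Subgroup.map_sup,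
        Subgroup.zpowers_eq_closure, Subgroup.zpowers_eq_closure, ← Subgroup.closure_union,
        Set.singleton_union, hgen, ← MonoidHom.range_eq_map, MonoidHom.range_eq_top.2 hg]
    rw [htop] at hsup
    exact hsup.of_equiv Subgroup.topEquiv
  have := Fact.mk hp
  obtain ⟨i, hi⟩ := IsPGroup.iff_card.1 hpgroup
  have h1 := Subgroup.card_eq_card_quotient_mul_card_subgroup N
  rw [hi] at h1
  rw [h1, Nat.ordCompl_mul, Nat.ordCompl_self_pow hp, one_mul,
    Nat.factorization_eq_zero_of_not_dvd hcop, pow_zero, Nat.div_one]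

theorem modEq_one_of_mul_pow_eq {g : G} {m i : ℕ} [Finite G] (h : a * g = g * a ^ m)
    (hg : g ^ i = 1) : m ^ i ≡ 1 [MOD orderOf a] := by
  have := mul_pow_eq_pow_mul h i
  rw [hg, mul_one, one_mul] at this
  rw [← pow_eq_pow_iff_modEq, pow_one, ← this]

theorem factorization_card_eq_of_pPrimeCentral [Finite G] (hp : p.Prime)
    (hA : (Subgroup.zpowers a).Normal) (hgen : Subgroup.closure {a, b} = ⊤)
    {s : ℕ} (hs : a * b ^ ordCompl[p] (orderOf b) = b ^ ordCompl[p] (orderOf b) * a ^ (s + 1))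
    (h : PPrimeCentral p a b) :
    (orderOf (a ^ s)).factorization p = (Nat.card (commutator G)).factorization p := by
  obtain ⟨r, hr⟩ := exists_mul_eq_mul_pow_succ hA b
  have hN := normal_zpowers_pow hA s
  set K := Subgroup.zpowers (a ^ s) with hK
  set u := ordCompl[p] (orderOf a) with hu
  rw [PPrimeCentral, ← hu] at h
  let f := QuotientGroup.mk' K
  have hfs : f (a ^ s) = 1 := (QuotientGroup.eq_one_iff _).2 (Subgroup.mem_zpowers _)
  have hc : Commute (f a) (f b ^ ordCompl[p] (orderOf b)) := by
    rw [commute_iff_eq, ← map_pow, ← map_mul, hs, pow_succ, map_mul, map_mul, hfs, one_mul]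
  have hd : Commute (f a ^ u) (f b ^ ordProj[p] (orderOf b)) := by
    rw [← map_pow, ← map_pow]
    exact (h.map f).symm
  have hb : Commute (f a ^ u) (f b) :=
    commute_of_commute_pow_of_coprime (coprime_ordCompl_ordProj hp (orderOf_pos b).ne')
      (hc.pow_left u) hd
  have hmem : (a ^ r) ^ u ∈ K := by
    rw [← QuotientGroup.eq_one_iff]
    change f ((a ^ r) ^ u) = 1
    have h1 := pow_mul_eq_mul_pow hr u
    have h2 : (a ^ r) ^ u = b⁻¹ * (a ^ u * b) * (a ^ u)⁻¹ := by
      rw [h1, ← pow_mul, add_mul, one_mul, pow_add]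
      group
    rw [h2, map_mul, map_mul, map_mul, map_pow, hb.eq, map_inv, map_inv, map_pow]
    group
  have hG : commutator G = Subgroup.zpowers (a ^ r) := commutator_eq_zpowers hA hgen hr
  have hcard : Nat.card (commutator G) = orderOf (a ^ r) := by rw [hG, Nat.card_zpowers]
  have h1 : orderOf (a ^ s) ∣ Nat.card (commutator G) := by
    rw [← Nat.card_zpowers]
    refine Subgroup.card_dvd_of_le ?_
    rw [Subgroup.zpowers_le]
    exact pow_mem_commutator hs
  have h2 : Nat.card (commutator G) ∣ u * orderOf (a ^ s) := by
    rw [hcard]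
    refine orderOf_dvd_of_pow_eq_one ?_
    rw [pow_mul, ← orderOf_dvd_iff_pow_eq_one, ← Nat.card_zpowers (a ^ s)]
    exact Subgroup.orderOf_dvd_natCard K hmem
  have hs0 := (orderOf_pos (a ^ s)).ne'
  have hu0 : u ≠ 0 := (Nat.ordCompl_pos p (orderOf_pos a).ne').ne'
  have hc0 : Nat.card (commutator G) ≠ 0 := Nat.card_pos.ne'
  have h3 := (Nat.factorization_le_iff_dvd hs0 hc0).2 h1 p
  have h4 := (Nat.factorization_le_iff_dvd hc0 (mul_ne_zero hu0 hs0)).2 h2 p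
  rw [Nat.factorization_mul hu0 hs0, Finsupp.add_apply,
    Nat.factorization_eq_zero_of_not_dvd (Nat.not_dvd_ordCompl hp (orderOf_pos a).ne'),
    zero_add] at h4
  exact le_antisymm h3 h4

theorem factorization_card_commutator_of_not_pPrimeCentral [Finite G] (hp : p.Prime)
    (hA : (Subgroup.zpowers a).Normal) (hgen : Subgroup.closure {a, b} = ⊤)
    (h : ¬ PPrimeCentral p a b) :
    (Nat.card (commutator G)).factorization p = (orderOf a).factorization p := by
  have ha0 := (orderOf_pos a).ne'
  obtain ⟨r, hr⟩ := exists_mul_eq_mul_pow_succ hA b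
  obtain ⟨t, ht⟩ := exists_mul_eq_mul_pow_succ hA (b ^ ordProj[p] (orderOf b))
  set d := b ^ ordProj[p] (orderOf b) with hd
  have hdk : d ^ ordCompl[p] (orderOf b) = 1 := by
    rw [hd, ← pow_mul, Nat.ordProj_mul_ordCompl_eq_self, pow_orderOf_eq_one]
  have hpt : ¬ p ∣ t := by
    intro hpt
    have h1 := (modEq_one_of_mul_pow_eq ht hdk).of_dvd (Nat.ordProj_dvd (orderOf a) p)
    have h2 := pow_dvd_of_pow_succ_pow_modEq_one hp
      (Nat.not_dvd_ordCompl hp (orderOf_pos b).ne') hpt h1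
    refine h ?_
    rw [PPrimeCentral, commute_iff_eq, ← hd, pow_mul_eq_mul_pow ht, add_mul, one_mul, pow_add]
    have h3 : a ^ (t * ordCompl[p] (orderOf a)) = 1 := by
      rw [← orderOf_dvd_iff_pow_eq_one]
      nth_rw 1 [← Nat.ordProj_mul_ordCompl_eq_self (orderOf a) p]
      exact Nat.mul_dvd_mul_right h2 _
    rw [h3, one_mul]
  have hG : commutator G = Subgroup.zpowers (a ^ r) := commutator_eq_zpowers hA hgen hr
  have h1 : Nat.card (commutator G) ∣ orderOf a := by
    rw [hG, Nat.card_zpowers]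
    exact orderOf_pow_dvd r
  have h2 : orderOf a ∣ t * Nat.card (commutator G) := by
    refine orderOf_dvd_of_pow_eq_one ?_
    rw [pow_mul, ← orderOf_dvd_iff_pow_eq_one]
    exact Subgroup.orderOf_dvd_natCard _ (pow_mem_commutator ht)
  have hc0 : Nat.card (commutator G) ≠ 0 := Nat.card_pos.ne'
  have ht0 : t ≠ 0 := by
    rintro rfl
    exact hpt (dvd_zero p)
  have h3 := (Nat.factorization_le_iff_dvd hc0 ha0).2 h1 p
  have h4 := (Nat.factorization_le_iff_dvd ha0 (mul_ne_zero ht0 hc0)).2 h2 p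
  rw [Nat.factorization_mul ht0 hc0, Finsupp.add_apply,
    Nat.factorization_eq_zero_of_not_dvd hpt, zero_add] at h4
  exact le_antisymm h3 h4

theorem factorization_orderOf_pow_lt_of_not_pPrimeCentral [Finite G] (hp : p.Prime)
    {s : ℕ} (hs : a * b ^ ordCompl[p] (orderOf b) = b ^ ordCompl[p] (orderOf b) * a ^ (s + 1))
    (h : ¬ PPrimeCentral p a b) :
    (orderOf (a ^ s)).factorization p < (orderOf a).factorization p := by
  have := Fact.mk hp
  have ha0 := (orderOf_pos a).ne'
  have hpa : p ∣ orderOf a := by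
    by_contra hpa
    refine h ?_
    rw [PPrimeCentral, Nat.factorization_eq_zero_of_not_dvd hpa, pow_zero, Nat.div_one,
      pow_orderOf_eq_one]
    exact Commute.one_right _
  have hps : p ∣ s := by
    have h1 : (b ^ ordCompl[p] (orderOf b)) ^ ordProj[p] (orderOf b) = 1 := by
      rw [← pow_mul, mul_comm, Nat.ordProj_mul_ordCompl_eq_self, pow_orderOf_eq_one]
    have h2 := (modEq_one_of_mul_pow_eq hs h1).of_dvd hpa
    rw [← ZMod.natCast_eq_natCast_iff] at h2
    push_cast at h2
    rw [ZMod.pow_card_pow] at h2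
    rw [← ZMod.natCast_eq_zero_iff]
    simpa using h2
  have h3 : orderOf (a ^ s) ∣ orderOf a / p := by
    refine orderOf_dvd_of_pow_eq_one ?_
    obtain ⟨v, rfl⟩ := hps
    rw [← pow_mul, mul_comm p v, mul_assoc, Nat.mul_div_cancel' hpa, mul_comm, pow_mul,
      pow_orderOf_eq_one, one_pow]
  have h0 : orderOf a / p ≠ 0 := (Nat.div_pos (Nat.le_of_dvd (orderOf_pos a) hpa) hp.pos).ne'
  have h4 := (Nat.factorization_le_iff_dvd (orderOf_pos (a ^ s)).ne' h0).2 h3 p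
  have h5 := hp.factorization_pos_of_dvd ha0 hpa
  rw [Nat.factorization_div hpa, Finsupp.tsub_apply, hp.factorization_self] at h4
  omega

theorem pPrimeCentral_iff [Finite G] (hp : p.Prime)
    (hA : (Subgroup.zpowers a).Normal) (hgen : Subgroup.closure {a, b} = ⊤)
    {s : ℕ} (hs : a * b ^ ordCompl[p] (orderOf b) = b ^ ordCompl[p] (orderOf b) * a ^ (s + 1)) :
    PPrimeCentral p a b ↔
      (orderOf (a ^ s)).factorization p = (Nat.card (commutator G)).factorization p := by
  refine ⟨factorization_card_eq_of_pPrimeCentral hp hA hgen hs, fun h => ?_⟩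
  by_contra hn
  rw [factorization_card_commutator_of_not_pPrimeCentral hp hA hgen hn] at h
  exact (factorization_orderOf_pow_lt_of_not_pPrimeCentral hp hs hn).ne h

end

theorem MetacyclicFact.exists_generators {G : Type*} [Group G] (f : MetacyclicFact G) :
    ∃ a b : G, f.A = Subgroup.zpowers a ∧ Subgroup.closure {a, b} = ⊤ := by
  obtain ⟨a, ha⟩ := Subgroup.isCyclic_iff_exists_zpowers_eq_top f.A |>.1 f.cyclicA
  obtain ⟨b, hb⟩ := Subgroup.isCyclic_iff_exists_zpowers_eq_top f.B |>.1 f.cyclicB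
  refine ⟨a, b, ha.symm, ?_⟩
  rw [eq_top_iff]
  intro g _
  obtain ⟨x, hx, y, hy, rfl⟩ := f.mul_cover g
  rw [← ha] at hx
  rw [← hb] at hy
  refine mul_mem ?_ ?_
  · exact Subgroup.zpowers_le.2 (Subgroup.subset_closure (by simp)) hx
  · exact Subgroup.zpowers_le.2 (Subgroup.subset_closure (by simp)) hy

theorem natPart_eq_of_factorization_eq {m n : ℕ} {σ : Set ℕ}
    (h : ∀ p ∈ σ, m.factorization p = n.factorization p) : natPart m σ = natPart n σ := by
  have key : ∀ l : ℕ, ∀ S : Finset ℕ, l.primeFactors ⊆ S → natPart l σ =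
      ∏ p ∈ S, if p ∈ σ then p ^ (l.factorization p) else 1 := by
    intro l S hS
    refine Finset.prod_subset hS fun p _ hp => ?_
    rw [← Nat.support_factorization, Finsupp.notMem_support_iff] at hp
    rw [hp, pow_zero, ite_self]
  rw [key m _ Finset.subset_union_left, key n (m.primeFactors ∪ n.primeFactors)
    Finset.subset_union_right]
  refine Finset.prod_congr rfl fun p _ => ?_
  split_ifs with hp
  · rw [h p hp]
  · rfl

/-- For each prime `p`, there is a normal subgroup cutting out `primeToKernel p` of the rational
group algebra and whose `p`-part detects whether `p` lies in `piSet G`. -/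
theorem exists_normal_primeToKernel {G : Type*} [Group G] [Finite G] (f : MetacyclicFact G)
    {p : ℕ} (hp : p.Prime) (hpG : p ∣ Nat.card G) :
    ∃ K : Subgroup G, ∃ _ : K.Normal,
      (∀ x : MonoidAlgebra ℚ G, x ∈ primeToKernel p (MonoidAlgebra ℚ G) ↔
        MonoidAlgebra.mapDomainAlgHom ℚ ℚ (QuotientGroup.mk' K) x = 0) ∧
      (p ∈ piSet G ↔ (Nat.card K).factorization p = (Nat.card (commutator G)).factorization p) ∧
      (p ∉ piSet G → (Nat.card (commutator G)).factorization p = (Nat.card f.A).factorization p) := by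
  obtain ⟨a, b, hAa, hgen⟩ := f.exists_generators
  have hA : (Subgroup.zpowers a).Normal := hAa ▸ f.normalA
  obtain ⟨r, hr⟩ := exists_mul_eq_mul_pow_succ hA b
  obtain ⟨s, hs⟩ := exists_mul_eq_mul_pow_succ hA (b ^ ordCompl[p] (orderOf b))
  have hK := normal_zpowers_pow hA s
  have hmem : p ∈ piSet G ↔ PPrimeCentral p a b :=
    ⟨pPrimeCentral_of_mem_piSet hA, mem_piSet_of_pPrimeCentral hp hpG hA hgen⟩
  refine ⟨Subgroup.zpowers (a ^ s), hK, ?_, ?_, ?_⟩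
  · refine mem_primeToKernel_iff hp hgen hr (n := (orderOf b).factorization p) ?_
      (Nat.not_dvd_ordCompl hp (orderOf_pos b).ne') hs _ ?_
    · rw [← pow_mul, mul_comm, Nat.ordProj_mul_ordCompl_eq_self, pow_orderOf_eq_one]
    · rw [pow_succ, mul_inv_cancel_right]
  · rw [hmem, Nat.card_zpowers]
    exact pPrimeCentral_iff hp hA hgen hs
  · rw [hmem, hAa, Nat.card_zpowers]
    exact factorization_card_commutator_of_not_pPrimeCentral hp hA hgen

theorem piSet_subset_of_algEquiv {G H : Type*} [Group G] [Group H] [Finite G] [Finite H]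
    (fG : MetacyclicFact G) (fH : MetacyclicFact H)
    (e : MonoidAlgebra ℚ G ≃ₐ[ℚ] MonoidAlgebra ℚ H) : piSet G ⊆ piSet H := by
  intro p hpG
  have hcard := card_eq_of_algEquiv e
  have hcomm := card_commutator_eq_of_algEquiv e
  obtain ⟨K, _, hK, hKG, -⟩ := exists_normal_primeToKernel fG hpG.1 hpG.2.1
  obtain ⟨L, _, hL, hLH, -⟩ := exists_normal_primeToKernel fH hpG.1 (hcard ▸ hpG.2.1)
  have hquot := card_quotient_eq_of_ker_iff e K L fun x => by
    rw [← hK, ← hL]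
    refine ⟨mem_primeToKernel_of_algEquiv e, fun h => ?_⟩
    simpa using mem_primeToKernel_of_algEquiv e.symm h
  have h1 := Subgroup.card_eq_card_quotient_mul_card_subgroup K
  have h2 := Subgroup.card_eq_card_quotient_mul_card_subgroup L
  rw [← hquot, ← hcard, h1] at h2
  rw [hLH, ← hcomm, ← Nat.eq_of_mul_eq_mul_left Nat.card_pos h2]
  exact hKG.1 hpG

/-- If `ℚG ≅ ℚH` for finite metacyclic `G, H`, then `π_G = π_H`, `π'_G = π'_H`,
`(m^G)_{π'} = (m^H)_{π'}` and `(n^G)_{π'} = (n^H)_{π'}`. -/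
theorem piSets_and_piPrimeParts_eq_of_qalgebra_iso {G H : Type*} [Group G] [Group H]
    [Finite G] [Finite H]
    (fG : MetacyclicFact G) (hfG : IsMinimalFact fG)
    (fH : MetacyclicFact H) (hfH : IsMinimalFact fH)
    (h : Nonempty (MonoidAlgebra ℚ G ≃ₐ[ℚ] MonoidAlgebra ℚ H)) :
    piSet G = piSet H ∧ piSet' G = piSet' H ∧
    natPart (mOf fG) (piSet' G) = natPart (mOf fH) (piSet' H) ∧
    natPart (nOf fG) (piSet' G) = natPart (nOf fH) (piSet' H) := by
  obtain ⟨e⟩ := h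
  have hcard := card_eq_of_algEquiv e
  have hcomm := card_commutator_eq_of_algEquiv e
  have hpi : piSet G = piSet H :=
    (piSet_subset_of_algEquiv fG fH e).antisymm (piSet_subset_of_algEquiv fH fG e.symm)
  have hpi' : piSet' G = piSet' H := by rw [piSet', piSet', hpi, hcard]
  have hA : ∀ p ∈ piSet' G, (Nat.card fG.A).factorization p = (Nat.card fH.A).factorization p := by
    intro p hp
    obtain ⟨-, -, -, -, hG⟩ := exists_normal_primeToKernel fG hp.1.1 hp.1.2
    obtain ⟨-, -, -, -, hH⟩ := exists_normal_primeToKernel fH hp.1.1 (hcard ▸ hp.1.2)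
    rw [← hG hp.2, ← hH (hpi ▸ hp.2), hcomm]
  refine ⟨hpi, hpi', ?_, ?_⟩
  · rw [← hpi']
    exact natPart_eq_of_factorization_eq hA
  · rw [← hpi']
    refine natPart_eq_of_factorization_eq fun p hp => ?_
    have hG := congrArg (fun n => n.factorization p) (Subgroup.card_mul_index fG.A)
    have hH := congrArg (fun n => n.factorization p) (Subgroup.card_mul_index fH.A)
    rw [Nat.factorization_mul Nat.card_pos.ne' Subgroup.index_ne_zero_of_finite,
      Finsupp.add_apply] at hG hH
    have := hA p hp
    rw [← hcard] at hH
    rw [nOf, nOf]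
    omega

end ArXiv230800432
end
end

section
/- Let p be a prime and let L be a finite abelian p-group which is the internal direct product of cyclic subgroups ⟨g⟩ and ⟨h⟩ with |g| ≥ |h|. Let C_L be the set of triples (i,y,x) with i ∈ {1,2} and 1 ≤ x ≤ y, where for i = 1 one requires y to divide |h|, and for i = 2 one requires that y divides |g|, p divides x, p divides y, and y divides |h|·x. For (i,y,x) ∈ C_L set K_{1,y,x} = ⟨g·h^x, h^y⟩ and K_{2,y,x} = ⟨g^x·h, g^y⟩. Then (i,y,x) ↦ K_{i,y,x} is a bijection from C_L onto the set of cocyclic subgroups of L. Moreover, for every (i,y,x) ∈ C_L one has [L : K_{i,y,x}] = y; ⟨g⟩ ∩ K_{1,y,x} = ⟨g^{y/x_p}⟩ and ⟨h⟩ ∩ K_{1,y,x} = ⟨h^y⟩; and ⟨g⟩ ∩ K_{2,y,x} = ⟨g^y⟩ and ⟨h⟩ ∩ K_{2,y,x} = ⟨h^{y/x_p}⟩. -/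
open scoped Classical

noncomputable section

namespace ArXiv230800432


/-- The map `(i,y,x) ↦ K_{i,y,x}` of the lemma on cocyclic subgroups. -/
def Kmap {L : Type*} [CommGroup L] (g h : L) : ℕ × ℕ × ℕ → Subgroup L := fun t =>
  if t.1 = 1 then Subgroup.closure {g * h ^ t.2.2, h ^ t.2.1}
  else Subgroup.closure {g ^ t.2.2 * h, g ^ t.2.1}

/-- The parameter set `C_L` of triples `(i,y,x)`. -/
def CLset {L : Type*} [CommGroup L] (p : ℕ) (g h : L) : Set (ℕ × ℕ × ℕ) :=
  {t | (t.1 = 1 ∨ t.1 = 2) ∧ 1 ≤ t.2.2 ∧ t.2.2 ≤ t.2.1 ∧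
    (t.1 = 1 → t.2.1 ∣ orderOf h) ∧
    (t.1 = 2 → t.2.1 ∣ orderOf g ∧ p ∣ t.2.2 ∧ p ∣ t.2.1 ∧ t.2.1 ∣ orderOf h * t.2.2)}

section CocyclicPair

variable {L : Type*} [CommGroup L]

theorem zpow_mul_zpow_mem_closure_iff {a b : L}
    (hdisj : Subgroup.zpowers a ⊓ Subgroup.zpowers b = ⊥) {x y : ℕ}
    (hyb : y ∣ orderOf b) (hya : y ∣ orderOf a * x) (m n : ℤ) :
    a ^ m * b ^ n ∈ Subgroup.closure {a * b ^ x, b ^ y} ↔ (y : ℤ) ∣ n - x * m := by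
  rw [Subgroup.mem_closure_pair]
  constructor
  · rintro ⟨u, v, huv⟩
    have huv' : a ^ u * b ^ (x * u + y * v) = a ^ m * b ^ n := by
      rw [← huv, mul_zpow, zpow_add, zpow_mul, zpow_mul, zpow_natCast, zpow_natCast, mul_assoc]
    have key : a ^ (u - m) = b ^ (n - (x * u + y * v)) := by
      rw [zpow_sub, zpow_sub, ← div_eq_mul_inv, ← div_eq_mul_inv, div_eq_div_iff_mul_eq_mul,
        huv', mul_comm]
    have hone : a ^ (u - m) = 1 := by
      rw [← Subgroup.mem_bot, ← hdisj]
      refine ⟨⟨_, rfl⟩, ?_⟩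
      rw [key]
      exact ⟨_, rfl⟩
    have ha : (orderOf a : ℤ) ∣ u - m := orderOf_dvd_iff_zpow_eq_one.mpr hone
    have hb : (orderOf b : ℤ) ∣ n - (x * u + y * v) :=
      orderOf_dvd_iff_zpow_eq_one.mpr (key ▸ hone)
    have h₁ : (y : ℤ) ∣ n - (x * u + y * v) := (Int.natCast_dvd_natCast.mpr hyb).trans hb
    have h₂ : (y : ℤ) ∣ (u - m) * x := by
      refine (Int.natCast_dvd_natCast.mpr hya).trans ?_
      push_cast
      exact mul_dvd_mul_right ha _
    have h₃ := (h₁.add h₂).add (dvd_mul_right (y : ℤ) v)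
    rwa [show n - (x * u + y * v) + (u - m) * x + y * v = n - x * m by ring] at h₃
  · rintro ⟨k, hk⟩
    refine ⟨m, k, ?_⟩
    have hn : n = x * m + y * k := by linarith
    rw [hn, mul_zpow, zpow_add, zpow_mul, zpow_mul, zpow_natCast, zpow_natCast, mul_assoc]

theorem zpow_right_mem_closure_iff {a b : L}
    (hdisj : Subgroup.zpowers a ⊓ Subgroup.zpowers b = ⊥) {x y : ℕ}
    (hyb : y ∣ orderOf b) (hya : y ∣ orderOf a * x) (n : ℤ) :
    b ^ n ∈ Subgroup.closure {a * b ^ x, b ^ y} ↔ (y : ℤ) ∣ n := by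
  simpa using zpow_mul_zpow_mem_closure_iff hdisj hyb hya 0 n

theorem zpow_left_mem_closure_iff {a b : L}
    (hdisj : Subgroup.zpowers a ⊓ Subgroup.zpowers b = ⊥) {x y : ℕ}
    (hyb : y ∣ orderOf b) (hya : y ∣ orderOf a * x) (m : ℤ) :
    a ^ m ∈ Subgroup.closure {a * b ^ x, b ^ y} ↔ (y : ℤ) ∣ x * m := by
  simpa using zpow_mul_zpow_mem_closure_iff hdisj hyb hya m 0

theorem orderOf_mk_right {a b : L}
    (hdisj : Subgroup.zpowers a ⊓ Subgroup.zpowers b = ⊥) {x y : ℕ}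
    (hyb : y ∣ orderOf b) (hya : y ∣ orderOf a * x) :
    orderOf (b : L ⧸ Subgroup.closure {a * b ^ x, b ^ y}) = y := by
  refine Nat.dvd_right_iff_eq.mp fun k => ?_
  rw [orderOf_dvd_iff_pow_eq_one, ← QuotientGroup.mk_pow, QuotientGroup.eq_one_iff,
    ← zpow_natCast b k, zpow_right_mem_closure_iff hdisj hyb hya, Int.natCast_dvd_natCast]

theorem zpowers_mk_right_eq_top {a b : L} (hcover : ∀ z : L, ∃ i j : ℤ, z = a ^ i * b ^ j)
    {K : Subgroup L} {x : ℕ} (hK : a * b ^ x ∈ K) :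
    Subgroup.zpowers (b : L ⧸ K) = ⊤ := by
  rw [Subgroup.eq_top_iff']
  intro q
  obtain ⟨z, rfl⟩ := QuotientGroup.mk_surjective q
  obtain ⟨i, j, rfl⟩ := hcover z
  refine ⟨j - x * i, ?_⟩
  change ((b : L ⧸ K)) ^ (j - x * i) = _
  rw [← QuotientGroup.mk_zpow, QuotientGroup.eq]
  convert K.zpow_mem hK i using 1
  rw [mul_zpow, ← zpow_natCast, ← zpow_mul, ← zpow_neg, mul_left_comm, ← zpow_add]
  congr 2
  ring

theorem index_eq_orderOf_of_zpowers_eq_top {K : Subgroup L} {b : L}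
    (hb : Subgroup.zpowers (b : L ⧸ K) = ⊤) : K.index = orderOf (b : L ⧸ K) := by
  rw [← Nat.card_zpowers, hb, Subgroup.card_top]
  rfl

theorem mul_pow_mem_closure (a b : L) (x y : ℕ) :
    a * b ^ x ∈ Subgroup.closure {a * b ^ x, b ^ y} :=
  Subgroup.subset_closure (Set.mem_insert _ _)

theorem index_closure_pair {a b : L} (hcover : ∀ z : L, ∃ i j : ℤ, z = a ^ i * b ^ j)
    (hdisj : Subgroup.zpowers a ⊓ Subgroup.zpowers b = ⊥) {x y : ℕ}
    (hyb : y ∣ orderOf b) (hya : y ∣ orderOf a * x) :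
    (Subgroup.closure {a * b ^ x, b ^ y}).index = y := by
  rw [index_eq_orderOf_of_zpowers_eq_top
    (zpowers_mk_right_eq_top hcover (mul_pow_mem_closure a b x y)),
    orderOf_mk_right hdisj hyb hya]

theorem zpowers_right_inf_closure {a b : L}
    (hdisj : Subgroup.zpowers a ⊓ Subgroup.zpowers b = ⊥) {x y : ℕ}
    (hyb : y ∣ orderOf b) (hya : y ∣ orderOf a * x) :
    Subgroup.zpowers b ⊓ Subgroup.closure {a * b ^ x, b ^ y} = Subgroup.zpowers (b ^ y) := by
  ext z
  simp only [Subgroup.mem_inf, Subgroup.mem_zpowers_iff]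
  constructor
  · rintro ⟨⟨n, rfl⟩, hn⟩
    obtain ⟨k, rfl⟩ := (zpow_right_mem_closure_iff hdisj hyb hya n).mp hn
    exact ⟨k, by rw [zpow_mul, zpow_natCast]⟩
  · rintro ⟨k, rfl⟩
    rw [show (b ^ y) ^ k = b ^ ((y : ℤ) * k) by rw [zpow_mul, zpow_natCast]]
    exact ⟨⟨_, rfl⟩, (zpow_right_mem_closure_iff hdisj hyb hya _).mpr (dvd_mul_right _ _)⟩

theorem zpowers_left_inf_closure {a b : L}
    (hdisj : Subgroup.zpowers a ⊓ Subgroup.zpowers b = ⊥) {x y : ℕ} (hx : 0 < x)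
    (hyb : y ∣ orderOf b) (hya : y ∣ orderOf a * x) :
    Subgroup.zpowers a ⊓ Subgroup.closure {a * b ^ x, b ^ y} =
      Subgroup.zpowers (a ^ (y / y.gcd x)) := by
  have hdvd (m : ℤ) : (y : ℤ) ∣ x * m ↔ ((y / y.gcd x : ℕ) : ℤ) ∣ m := by
    rw [Int.natCast_dvd, Int.natCast_dvd, Int.natAbs_mul, Int.natAbs_natCast]
    have hgcd := Nat.gcd_pos_of_pos_right y hx
    nth_rw 1 [← Nat.div_mul_cancel (Nat.gcd_dvd_left y x)]
    nth_rw 3 [← Nat.div_mul_cancel (Nat.gcd_dvd_right y x)]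
    rw [mul_right_comm, Nat.mul_dvd_mul_iff_right hgcd,
      (Nat.coprime_div_gcd_div_gcd hgcd).dvd_mul_left]
  ext z
  simp only [Subgroup.mem_inf, Subgroup.mem_zpowers_iff]
  constructor
  · rintro ⟨⟨n, rfl⟩, hn⟩
    obtain ⟨k, rfl⟩ := (hdvd n).mp ((zpow_left_mem_closure_iff hdisj hyb hya n).mp hn)
    exact ⟨k, by rw [zpow_mul, zpow_natCast]⟩
  · rintro ⟨k, rfl⟩
    rw [← zpow_natCast, ← zpow_mul]
    exact ⟨⟨_, rfl⟩, (zpow_left_mem_closure_iff hdisj hyb hya _).mpr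
      ((hdvd _).mpr (dvd_mul_right _ _))⟩

theorem eq_of_closure_pair_eq {a b : L}
    (hdisj : Subgroup.zpowers a ⊓ Subgroup.zpowers b = ⊥) {x x' y : ℕ}
    (hx : 1 ≤ x) (hxy : x ≤ y) (hx' : 1 ≤ x') (hxy' : x' ≤ y)
    (hyb : y ∣ orderOf b) (hya : y ∣ orderOf a * x)
    (heq : Subgroup.closure {a * b ^ x, b ^ y} = Subgroup.closure {a * b ^ x', b ^ y}) :
    x = x' := by
  have hmem := mul_pow_mem_closure a b x' y
  rw [← heq] at hmem
  have hdvd := (zpow_mul_zpow_mem_closure_iff hdisj hyb hya 1 x').mp (by simpa using hmem)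
  rw [mul_one] at hdvd
  have h0 := Int.eq_zero_of_abs_lt_dvd hdvd (by rw [abs_lt]; omega)
  omega

theorem exists_eq_closure_pair [Finite L] {a b : L}
    (hcover : ∀ z : L, ∃ i j : ℤ, z = a ^ i * b ^ j)
    (hdisj : Subgroup.zpowers a ⊓ Subgroup.zpowers b = ⊥) {K : Subgroup L}
    (hb : Subgroup.zpowers (b : L ⧸ K) = ⊤) :
    ∃ x, 1 ≤ x ∧ x ≤ K.index ∧ K.index ∣ orderOf b ∧ K.index ∣ orderOf a * x ∧
      a * b ^ x ∈ K ∧ K = Subgroup.closure {a * b ^ x, b ^ K.index} := by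
  have hidx := index_eq_orderOf_of_zpowers_eq_top hb
  have hpos : 0 < K.index := Nat.pos_of_ne_zero K.index_ne_zero_of_finite
  have mem_iff (n : ℤ) : b ^ n ∈ K ↔ (K.index : ℤ) ∣ n := by
    rw [hidx, orderOf_dvd_iff_zpow_eq_one, ← QuotientGroup.mk_zpow, QuotientGroup.eq_one_iff]
  obtain ⟨i, hi⟩ : (a : L ⧸ K) ∈ Subgroup.zpowers (b : L ⧸ K) := hb ▸ Subgroup.mem_top _
  change (b : L ⧸ K) ^ i = a at hi
  obtain ⟨x, hx1, hxy, hdvd⟩ :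
      ∃ x : ℕ, 1 ≤ x ∧ x ≤ K.index ∧ (K.index : ℤ) ∣ i + x := by
    have h1 := Int.emod_nonneg i (by omega : (K.index : ℤ) ≠ 0)
    have h2 := Int.emod_lt_of_pos i (by omega : (0 : ℤ) < K.index)
    refine ⟨(K.index - i % K.index).toNat, by omega, by omega, ?_⟩
    rw [Int.toNat_of_nonneg (by omega)]
    refine ⟨i / K.index + 1, ?_⟩
    linarith [Int.emod_add_mul_ediv i K.index]
  have hmem : a * b ^ x ∈ K := by
    rw [← QuotientGroup.eq_one_iff, QuotientGroup.mk_mul, ← hi, ← zpow_natCast,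
      QuotientGroup.mk_zpow, ← zpow_add, ← orderOf_dvd_iff_zpow_eq_one, ← hidx]
    exact hdvd
  have hyb : K.index ∣ orderOf b := by
    rw [← Int.natCast_dvd_natCast, ← mem_iff, zpow_natCast, pow_orderOf_eq_one]
    exact K.one_mem
  have hya : K.index ∣ orderOf a * x := by
    rw [← Int.natCast_dvd_natCast, ← mem_iff, zpow_natCast]
    simpa [mul_pow, ← pow_mul, pow_orderOf_eq_one, mul_comm] using K.pow_mem hmem (orderOf a)
  refine ⟨x, hx1, hxy, hyb, hya, hmem, ?_⟩
  ext z
  obtain ⟨m, n, rfl⟩ := hcover z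
  have hz : (a * b ^ x) ^ m * b ^ (n - x * m) = a ^ m * b ^ n := by
    rw [mul_zpow, ← zpow_natCast, ← zpow_mul, mul_assoc, ← zpow_add]
    congr 2
    ring
  rw [zpow_mul_zpow_mem_closure_iff hdisj hyb hya, ← mem_iff, ← hz,
    K.mul_mem_cancel_left (K.zpow_mem hmem m)]

end CocyclicPair

theorem zpowers_zpow_eq_top_of_not_dvd {G : Type*} [Group G] [Finite G] {p : ℕ}
    (hp : p.Prime) (hG : IsPGroup p G) {c : G} (hc : Subgroup.zpowers c = ⊤) {n : ℤ}
    (hn : ¬ (p : ℤ) ∣ n) : Subgroup.zpowers (c ^ n) = ⊤ := by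
  have := Fact.mk hp
  obtain ⟨k, hk⟩ := IsPGroup.iff_orderOf.mp hG c
  obtain ⟨u, v, huv⟩ : IsCoprime ((p : ℤ) ^ k) n :=
    ((Nat.prime_iff_prime_int.mp hp).coprime_iff_not_dvd.mpr hn).pow_left
  rw [eq_top_iff, ← hc, Subgroup.zpowers_le]
  refine ⟨v, ?_⟩
  change (c ^ n) ^ v = c
  have hpk : c ^ ((p : ℤ) ^ k) = 1 := by
    rw [← orderOf_dvd_iff_zpow_eq_one, hk]
    push_cast
    rfl
  calc (c ^ n) ^ v = c ^ (u * (p : ℤ) ^ k + v * n) := by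
        rw [zpow_add, mul_comm u, zpow_mul, hpk, one_zpow, one_mul, mul_comm v, zpow_mul]
    _ = c := by rw [huv, zpow_one]

theorem zpowers_eq_top_or_of_isCyclic {G : Type*} [CommGroup G] [Finite G] [IsCyclic G] {p : ℕ}
    (hp : p.Prime) (hG : IsPGroup p G) {a b : G} (hcover : ∀ z : G, ∃ i j : ℤ, z = a ^ i * b ^ j) :
    Subgroup.zpowers a = ⊤ ∨ Subgroup.zpowers b = ⊤ := by
  have := Fact.mk hp
  obtain ⟨c, hc⟩ := IsCyclic.exists_zpow_surjective (G := G)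
  have hctop : Subgroup.zpowers c = ⊤ := by
    rw [Subgroup.eq_top_iff']
    exact hc
  obtain ⟨s, rfl⟩ := hc a
  obtain ⟨t, rfl⟩ := hc b
  by_cases hs : (p : ℤ) ∣ s
  · by_cases ht : (p : ℤ) ∣ t
    · obtain ⟨i, j, hij⟩ := hcover c
      have hndvd : ¬ (p : ℤ) ∣ s * i + t * j - 1 := fun h => by
        have := (Int.dvd_iff_dvd_of_dvd_sub h).mp ((hs.mul_right i).add (ht.mul_right j))
        exact (Nat.prime_iff_prime_int.mp hp).not_dvd_one this
      have hone : c ^ (s * i + t * j - 1) = 1 := by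
        rw [zpow_sub, zpow_add, zpow_mul, zpow_mul, zpow_one, ← hij, mul_inv_cancel]
      have htop := zpowers_zpow_eq_top_of_not_dvd hp hG hctop hndvd
      rw [hone, Subgroup.zpowers_one_eq_bot] at htop
      left
      rw [eq_top_iff, ← htop]
      exact bot_le
    · exact Or.inr (zpowers_zpow_eq_top_of_not_dvd hp hG hctop ht)
  · exact Or.inl (zpowers_zpow_eq_top_of_not_dvd hp hG hctop hs)

theorem gcd_eq_ordProj_of_le {p k x : ℕ} (hp : p.Prime) (hx : 1 ≤ x) (hxy : x ≤ p ^ k) :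
    (p ^ k).gcd x = ordProj[p] x := by
  obtain ⟨j, hj, hgcd⟩ := (Nat.dvd_prime_pow hp).mp (Nat.gcd_dvd_left (p ^ k) x)
  refine Nat.dvd_antisymm ?_ (Nat.dvd_gcd ?_ (Nat.ordProj_dvd x p))
  · rw [hgcd]
    refine pow_dvd_pow p ((hp.pow_dvd_iff_le_factorization (by omega)).mp ?_)
    rw [← hgcd]
    exact Nat.gcd_dvd_right _ _
  · refine pow_dvd_pow p ((Nat.pow_le_pow_iff_right hp.one_lt).mp ?_)
    exact (Nat.le_of_dvd hx (Nat.ordProj_dvd x p)).trans hxy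

theorem Kmap_one {L : Type*} [CommGroup L] (g h : L) (y x : ℕ) :
    Kmap g h (1, y, x) = Subgroup.closure {g * h ^ x, h ^ y} := by
  simp [Kmap]

theorem Kmap_two {L : Type*} [CommGroup L] (g h : L) (y x : ℕ) :
    Kmap g h (2, y, x) = Subgroup.closure {h * g ^ x, g ^ y} := by
  simp [Kmap, mul_comm h]

theorem zpowers_mk_ne_top_of_dvd {L : Type*} [CommGroup L] {p : ℕ} (hp : p.Prime) {a b : L}
    (hdisj : Subgroup.zpowers a ⊓ Subgroup.zpowers b = ⊥) {x y : ℕ}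
    (hyb : y ∣ orderOf b) (hya : y ∣ orderOf a * x) (hpx : p ∣ x) (hpy : p ∣ y) :
    Subgroup.zpowers (a : L ⧸ Subgroup.closure {a * b ^ x, b ^ y}) ≠ ⊤ := by
  intro htop
  obtain ⟨i, hi⟩ : (b : L ⧸ Subgroup.closure {a * b ^ x, b ^ y}) ∈ Subgroup.zpowers
    (a : L ⧸ Subgroup.closure {a * b ^ x, b ^ y}) := htop ▸ Subgroup.mem_top _
  change (a : L ⧸ Subgroup.closure {a * b ^ x, b ^ y}) ^ i = b at hi
  rw [← QuotientGroup.mk_zpow, QuotientGroup.eq, ← zpow_neg] at hi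
  have hdvd := (zpow_mul_zpow_mem_closure_iff hdisj hyb hya (-i) 1).mp (by rwa [zpow_one])
  have h1 : (p : ℤ) ∣ 1 - x * -i := (Int.natCast_dvd_natCast.mpr hpy).trans hdvd
  have h2 : (p : ℤ) ∣ x * -i := (Int.natCast_dvd_natCast.mpr hpx).mul_right _
  exact (Nat.prime_iff_prime_int.mp hp).not_dvd_one ((dvd_sub_left h2).mp h1)

/-- Classification of the cocyclic subgroups of a two-generated abelian `p`-group. -/
theorem cocyclic_subgroups_of_rank_two_abelian_pGroup
    {L : Type*} [CommGroup L] [Finite L] (p : ℕ) (hp : p.Prime)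
    (hL : IsPGroup p L) (g h : L)
    (hcover : ∀ x : L, ∃ i j : ℤ, x = g ^ i * h ^ j)
    (hdisj : Subgroup.zpowers g ⊓ Subgroup.zpowers h = ⊥)
    (horder : orderOf h ≤ orderOf g) :
    Set.BijOn (Kmap g h) (CLset p g h) {K : Subgroup L | IsCyclic (L ⧸ K)} ∧
    ∀ t ∈ CLset p g h,
      (Kmap g h t).index = t.2.1 ∧
      (t.1 = 1 →
        Subgroup.zpowers g ⊓ Kmap g h t =
          Subgroup.zpowers (g ^ (t.2.1 / ordProj[p] t.2.2)) ∧
        Subgroup.zpowers h ⊓ Kmap g h t = Subgroup.zpowers (h ^ t.2.1)) ∧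
      (t.1 = 2 →
        Subgroup.zpowers g ⊓ Kmap g h t = Subgroup.zpowers (g ^ t.2.1) ∧
        Subgroup.zpowers h ⊓ Kmap g h t =
          Subgroup.zpowers (h ^ (t.2.1 / ordProj[p] t.2.2))) := by
  have := Fact.mk hp
  have hcover' : ∀ z : L, ∃ i j : ℤ, z = h ^ i * g ^ j := fun z => by
    obtain ⟨i, j, rfl⟩ := hcover z
    exact ⟨j, i, mul_comm _ _⟩
  have hdisj' : Subgroup.zpowers h ⊓ Subgroup.zpowers g = ⊥ := by rwa [inf_comm]
  obtain ⟨kg, hkg⟩ := IsPGroup.iff_orderOf.mp hL g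
  obtain ⟨kh, hkh⟩ := IsPGroup.iff_orderOf.mp hL h
  have hdvd : orderOf h ∣ orderOf g := by
    rw [hkg, hkh] at horder ⊢
    exact pow_dvd_pow p ((Nat.pow_le_pow_iff_right hp.one_lt).mp horder)
  have hindex : ∀ t ∈ CLset p g h, (Kmap g h t).index = t.2.1 := by
    rintro ⟨i, y, x⟩ ⟨rfl | rfl, hx, hxy, h1, h2⟩
    · rw [Kmap_one]
      exact index_closure_pair hcover hdisj (h1 rfl) (((h1 rfl).trans hdvd).mul_right x)
    · rw [Kmap_two]
      exact index_closure_pair hcover' hdisj' (h2 rfl).1 (h2 rfl).2.2.2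
  have hne : ∀ y x y' x', (1, y, x) ∈ CLset p g h → (2, y', x') ∈ CLset p g h →
      Kmap g h (1, y, x) ≠ Kmap g h (2, y', x') := by
    rintro y x y' x' - ⟨-, -, -, -, h2⟩ heq
    obtain ⟨hyg, hpx, hpy, hyh⟩ := h2 rfl
    rw [Kmap_two] at heq
    refine zpowers_mk_ne_top_of_dvd hp hdisj' hyg hyh hpx hpy ?_
    refine zpowers_mk_right_eq_top (x := x) hcover ?_
    rw [← heq, Kmap_one]
    exact mul_pow_mem_closure g h x y
  refine ⟨⟨?_, ?_, ?_⟩, ?_⟩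
  · rintro ⟨i, y, x⟩ ⟨rfl | rfl, -⟩
    · rw [Kmap_one]
      exact isCyclic_iff_exists_zpowers_eq_top.mpr
        ⟨_, zpowers_mk_right_eq_top hcover (mul_pow_mem_closure g h x y)⟩
    · rw [Kmap_two]
      exact isCyclic_iff_exists_zpowers_eq_top.mpr
        ⟨_, zpowers_mk_right_eq_top hcover' (mul_pow_mem_closure h g x y)⟩
  · rintro ⟨i, y, x⟩ ht ⟨i', y', x'⟩ ht' heq
    obtain rfl : y = y' := by simpa only [heq, hindex _ ht'] using (hindex _ ht).symm
    obtain ⟨hi, hx, hxy, h1, h2⟩ := id ht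
    obtain ⟨hi', hx', hxy', h1', h2'⟩ := id ht'
    dsimp only at *
    rcases hi with rfl | rfl <;> rcases hi' with rfl | rfl
    · rw [Kmap_one, Kmap_one] at heq
      rw [eq_of_closure_pair_eq hdisj hx hxy hx' hxy' (h1 rfl)
        (((h1 rfl).trans hdvd).mul_right x) heq]
    · exact absurd heq (hne _ _ _ _ ht ht')
    · exact absurd heq.symm (hne _ _ _ _ ht' ht)
    · rw [Kmap_two, Kmap_two] at heq
      rw [eq_of_closure_pair_eq hdisj' hx hxy hx' hxy' (h2 rfl).1 (h2 rfl).2.2.2 heq]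
  · intro K hK
    have : IsCyclic (L ⧸ K) := hK
    have hLK : IsPGroup p (L ⧸ K) := hL.to_quotient K
    by_cases hh : Subgroup.zpowers (h : L ⧸ K) = ⊤
    · obtain ⟨x, hx, hxy, hyb, -, -, hKeq⟩ := exists_eq_closure_pair hcover hdisj hh
      exact ⟨(1, K.index, x), ⟨Or.inl rfl, hx, hxy, fun _ => hyb, fun h => by simp at h⟩,
        (Kmap_one g h _ _).trans hKeq.symm⟩
    · have hg : Subgroup.zpowers (g : L ⧸ K) = ⊤ := by
        refine (zpowers_eq_top_or_of_isCyclic hp hLK fun q => ?_).resolve_right hh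
        obtain ⟨z, rfl⟩ := QuotientGroup.mk_surjective q
        obtain ⟨i, j, rfl⟩ := hcover z
        exact ⟨i, j, rfl⟩
      obtain ⟨x, hx, hxy, hyb, hya, hmem, hKeq⟩ := exists_eq_closure_pair hcover' hdisj' hg
      have hpx : p ∣ x := by
        by_contra hpx
        have hpx' : ¬ (p : ℤ) ∣ -x := by rwa [dvd_neg, Int.natCast_dvd_natCast]
        have htop := zpowers_zpow_eq_top_of_not_dvd hp hLK hg hpx'
        rw [← QuotientGroup.eq_one_iff, QuotientGroup.mk_mul, QuotientGroup.mk_pow,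
          mul_eq_one_iff_eq_inv] at hmem
        rw [zpow_neg, zpow_natCast, ← hmem] at htop
        exact hh htop
      have hpy : p ∣ K.index := by
        obtain ⟨k, -, hk⟩ := (Nat.dvd_prime_pow hp).mp (hkg ▸ hyb)
        rw [hk]
        refine dvd_pow_self p fun hk0 => hh ?_
        rw [hk0, pow_zero, Subgroup.index_eq_one] at hk
        have := QuotientGroup.subsingleton_iff.mpr hk
        exact Subsingleton.elim _ _
      exact ⟨(2, K.index, x), ⟨Or.inr rfl, hx, hxy, fun h => by simp at h,
        fun _ => ⟨hyb, hpx, hpy, hya⟩⟩, (Kmap_two g h _ _).trans hKeq.symm⟩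
  · intro t ht
    refine ⟨hindex t ht, ?_⟩
    obtain ⟨i, y, x⟩ := t
    obtain ⟨-, hx, hxy, h1, h2⟩ := ht
    dsimp only at *
    refine ⟨?_, ?_⟩
    · rintro rfl
      have hyh := h1 rfl
      have hyg := (hyh.trans hdvd).mul_right x
      obtain ⟨k, -, rfl⟩ := (Nat.dvd_prime_pow hp).mp (hkh ▸ hyh)
      rw [Kmap_one, ← gcd_eq_ordProj_of_le hp hx hxy]
      exact ⟨zpowers_left_inf_closure hdisj hx hyh hyg, zpowers_right_inf_closure hdisj hyh hyg⟩
    · rintro rfl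
      obtain ⟨hyg, -, -, hyh⟩ := h2 rfl
      obtain ⟨k, -, rfl⟩ := (Nat.dvd_prime_pow hp).mp (hkg ▸ hyg)
      rw [Kmap_two, ← gcd_eq_ordProj_of_le hp hx hxy]
      exact ⟨zpowers_right_inf_closure hdisj' hyg hyh, zpowers_left_inf_closure hdisj' hx hyg hyh⟩

end ArXiv230800432
end
end
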